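/- arXiv:2603.00411 — 9 statements merged into one kernel-verified Lean document; each statement's English description precedes it below -/
import Mathlib

section
/- Under generalized assignment constraints and additive valuations, an FEF allocation always exists: for any sizes s_{i,g} ≥ 0, budgets B_i ≥ 0, and nonnegative values v_{i,g}, there exists a feasible allocation in which no agent feasibly envies any other agent or the charity. -/
open Finset

/-- The share of good `g` of agent `i` given participation levels `t`. -/
noncomputable def shr {n m : ℕ} (t : Fin n → Fin m → ℝ) (i : Fin n) (g : Fin m) : ℝ :=
  t i g / max 1 (∑ k, t k g)

lemma max_pos_shr (a : ℝ) : (0 : ℝ) < max 1 a := lt_of_lt_of_le one_pos (le_max_left _ _)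

lemma continuous_shr {n m : ℕ} (i : Fin n) (g : Fin m) :
    Continuous (fun t : Fin n → Fin m → ℝ => shr t i g) := by
  unfold shr
  refine Continuous.div (by fun_prop) (by fun_prop) (fun t => (max_pos_shr _).ne')

/-- The compact set of candidate multipliers and participation levels. -/
def candSet {n m : ℕ} (v s : Fin n → Fin m → ℝ) (B : Fin n → ℝ) (M : ℝ) :
    Set ((Fin n → ℝ) × (Fin n → Fin m → ℝ)) :=
  {p | (∀ i, 0 ≤ p.1 i ∧ p.1 i ≤ M) ∧ (∀ i g, 0 ≤ p.2 i g ∧ p.2 i g ≤ 1) ∧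
    (∀ i g, (p.2 i g = 1 ∨ v i g - p.1 i * s i g ≤ 0) ∧
      (p.2 i g = 0 ∨ 0 ≤ v i g - p.1 i * s i g)) ∧
    (∀ i, ∑ g, s i g * shr p.2 i g ≤ B i)}

lemma candSet_compact {n m : ℕ} (v s : Fin n → Fin m → ℝ) (B : Fin n → ℝ) (M : ℝ) :
    IsCompact (candSet v s B M) := by
  have hK : IsCompact (Set.Icc (0 : (Fin n → ℝ) × (Fin n → Fin m → ℝ))
      ((fun _ => M), (fun _ _ => 1))) := isCompact_Icc
  refine hK.of_isClosed_subset ?_ ?_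
  · have h1 : ∀ i g, Continuous
        (fun p : (Fin n → ℝ) × (Fin n → Fin m → ℝ) => v i g - p.1 i * s i g) := by
      intro i g; fun_prop
    have h2 : ∀ i g, Continuous
        (fun p : (Fin n → ℝ) × (Fin n → Fin m → ℝ) => p.2 i g) := by
      intro i g; fun_prop
    have h3 : ∀ i, Continuous
        (fun p : (Fin n → ℝ) × (Fin n → Fin m → ℝ) => p.1 i) := by
      intro i; fun_prop
    have h4 : ∀ i, Continuous
        (fun p : (Fin n → ℝ) × (Fin n → Fin m → ℝ) => ∑ g, s i g * shr p.2 i g) := by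
      intro i
      exact continuous_finsetSum _ fun g _ =>
        continuous_const.mul ((continuous_shr i g).comp continuous_snd)
    unfold candSet
    simp only [Set.ofPred_and, Set.ofPred_forall, Set.ofPred_or]
    refine IsClosed.inter ?_ (IsClosed.inter ?_ (IsClosed.inter ?_ ?_))
    · exact isClosed_iInter fun i => (isClosed_le continuous_const (h3 i)).inter
        (isClosed_le (h3 i) continuous_const)
    · exact isClosed_iInter fun i => isClosed_iInter fun g =>
        (isClosed_le continuous_const (h2 i g)).inter (isClosed_le (h2 i g) continuous_const)
    · exact isClosed_iInter fun i => isClosed_iInter fun g =>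
        ((isClosed_eq (h2 i g) continuous_const).union
          (isClosed_le (h1 i g) continuous_const)).inter
        ((isClosed_eq (h2 i g) continuous_const).union
          (isClosed_le continuous_const (h1 i g)))
    · exact isClosed_iInter fun i => isClosed_le (h4 i) continuous_const
  · rintro ⟨l, t⟩ ⟨h1, h2, -, -⟩
    exact ⟨⟨fun i => (h1 i).1, fun i g => (h2 i g).1⟩,
      ⟨fun i => (h1 i).2, fun i g => (h2 i g).2⟩⟩

lemma candSet_nonempty {n m : ℕ} (v s : Fin n → Fin m → ℝ) (B : Fin n → ℝ)
    (hv : ∀ i g, 0 ≤ v i g) (hs : ∀ i g, 0 ≤ s i g) (hB : ∀ i, 0 ≤ B i) :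
    ∃ M, (candSet v s B M).Nonempty := by
  have hnn : ∀ i g, 0 ≤ v i g / s i g := fun i g => div_nonneg (hv i g) (hs i g)
  refine ⟨∑ i, ∑ g, v i g / s i g, ((fun _ => ∑ i, ∑ g, v i g / s i g),
    (fun i g => if s i g = 0 then 1 else 0)), ?_, ?_, ?_, ?_⟩
  · intro i
    dsimp only
    exact ⟨Finset.sum_nonneg fun i _ => Finset.sum_nonneg fun g _ => hnn i g, le_rfl⟩
  · intro i g
    dsimp only
    split_ifs <;> norm_num
  · intro i g
    dsimp only
    by_cases h : s i g = 0
    · simp [h, hv i g]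
    · have hpos : 0 < s i g := lt_of_le_of_ne (hs i g) (Ne.symm h)
      refine ⟨Or.inr ?_, Or.inl (by simp [h])⟩
      have h1 : v i g / s i g ≤ ∑ i, ∑ g, v i g / s i g :=
        (Finset.single_le_sum (f := fun g => v i g / s i g)
          (fun g _ => hnn i g) (Finset.mem_univ g)).trans
        (Finset.single_le_sum (f := fun i => ∑ g, v i g / s i g)
          (fun i _ => Finset.sum_nonneg fun g _ => hnn i g) (Finset.mem_univ i))
      rw [div_le_iff₀ hpos] at h1
      linarith
  · intro i
    refine le_trans (le_of_eq (Finset.sum_eq_zero fun g _ => ?_)) (hB i)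
    by_cases h : s i g = 0
    · simp [h]
    · simp [shr, h]

/-- A minimizer of `∑ l - ∑ t` satisfies complementary slackness. -/
lemma exists_complementary {n m : ℕ} (v s : Fin n → Fin m → ℝ) (B : Fin n → ℝ)
    (hv : ∀ i g, 0 ≤ v i g) (hs : ∀ i g, 0 ≤ s i g) (hB : ∀ i, 0 ≤ B i) :
    ∃ M, ∃ p ∈ candSet v s B M, ∀ i, 0 < p.1 i → ∑ g, s i g * shr p.2 i g = B i := by
  obtain ⟨M, hne⟩ := candSet_nonempty v s B hv hs hB
  have hcont : Continuous (fun p : (Fin n → ℝ) × (Fin n → Fin m → ℝ) =>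
      ∑ i, p.1 i - ∑ i, ∑ g, p.2 i g) := by fun_prop
  obtain ⟨⟨l, t⟩, hp, hmin⟩ := (candSet_compact v s B M).exists_isMinOn hne hcont.continuousOn
  refine ⟨M, (l, t), hp, ?_⟩
  obtain ⟨hl, ht, hw, hf⟩ := hp
  dsimp only at hl ht hw hf ⊢
  intro i hli
  by_contra hne'
  have hlt : ∑ g, s i g * shr t i g < B i := lt_of_le_of_ne (hf i) hne'
  by_cases hex : ∃ g, v i g - l i * s i g = 0 ∧ t i g < 1
  · obtain ⟨g, hwg, htg⟩ := hex
    let t' : ℝ → Fin n → Fin m → ℝ := fun δ k h => t k h + if k = i ∧ h = g then δ else 0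
    have ht'0 : t' 0 = t := by funext k h; simp [t']
    have hct : Continuous t' := by
      refine continuous_pi fun k => continuous_pi fun h => ?_
      by_cases hkh : k = i ∧ h = g
      · simp only [t', hkh, and_self, if_true]; fun_prop
      · simp only [t', hkh, if_false]; fun_prop
    have hcf : Continuous (fun δ => ∑ h, s i h * shr (t' δ) i h) :=
      continuous_finsetSum _ fun h _ =>
        continuous_const.mul ((continuous_shr i h).comp hct)
    have hev : ∀ᶠ δ in nhds (0 : ℝ), ∑ h, s i h * shr (t' δ) i h < B i :=
      hcf.continuousAt.eventually_lt continuousAt_const (by simpa [ht'0] using hlt)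
    have hev2 : ∀ᶠ δ in nhds (0 : ℝ), δ < 1 - t i g :=
      eventually_lt_nhds (by linarith)
    obtain ⟨δ, ⟨hδ1, hδ2⟩, hδ⟩ := (((hev.and hev2).filter_mono nhdsWithin_le_nhds).and
      (self_mem_nhdsWithin (s := Set.Ioi (0 : ℝ)))).exists
    have hδ0 : 0 < δ := hδ
    have hge : ∀ k h, t k h ≤ t' δ k h := by
      intro k h
      simp only [t']
      split_ifs <;> linarith
    have hmem : ((l, t' δ) : (Fin n → ℝ) × (Fin n → Fin m → ℝ)) ∈ candSet v s B M := by
      refine ⟨hl, ?_, ?_, ?_⟩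
      · intro k h
        refine ⟨(ht k h).1.trans (hge k h), ?_⟩
        by_cases hkh : k = i ∧ h = g
        · obtain ⟨rfl, rfl⟩ := hkh
          simp [t']; linarith
        · simp [t', hkh, (ht k h).2]
      · intro k h
        by_cases hkh : k = i ∧ h = g
        · obtain ⟨rfl, rfl⟩ := hkh
          exact ⟨Or.inr hwg.le, Or.inr hwg.ge⟩
        · simpa [t', hkh] using hw k h
      · intro k
        by_cases hk : k = i
        · subst hk; exact hδ1.le
        · refine le_trans (Finset.sum_le_sum fun h _ => ?_) (hf k)
          refine mul_le_mul_of_nonneg_left ?_ (hs k h)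
          have : t' δ k h = t k h := by simp [t', hk]
          simp only [shr]
          rw [this]
          exact div_le_div_of_nonneg_left (ht k h).1 (max_pos_shr _)
            (max_le_max le_rfl (Finset.sum_le_sum fun j _ => hge j h))
    have h1 := hmin hmem
    have h1' : ∑ i, l i - ∑ i, ∑ g, t i g ≤ ∑ i, l i - ∑ i, ∑ g, t' δ i g := h1
    have h2 : ∑ i, ∑ g, t i g < ∑ i, ∑ g, t' δ i g := by
      refine Finset.sum_lt_sum (fun k _ => Finset.sum_le_sum fun h _ => hge k h)
        ⟨i, Finset.mem_univ _, Finset.sum_lt_sum (fun h _ => hge i h)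
          ⟨g, Finset.mem_univ _, ?_⟩⟩
      simp [t', hδ0]
    linarith
  · push Not at hex
    have hev : ∀ᶠ δ in nhds (0 : ℝ), ∀ g, v i g - l i * s i g < 0 →
        v i g - (l i - δ) * s i g < 0 := by
      refine Filter.eventually_all.2 fun g => ?_
      by_cases hg : v i g - l i * s i g < 0
      · have hc : Continuous (fun δ : ℝ => v i g - (l i - δ) * s i g) := by fun_prop
        filter_upwards [hc.continuousAt.eventually_lt (continuousAt_const (y := (0 : ℝ)))
          (by simpa using hg)] with δ hδ _ using hδ
      · exact Filter.Eventually.of_forall fun δ h => absurd h hg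
    have hev2 : ∀ᶠ δ in nhds (0 : ℝ), δ < l i := eventually_lt_nhds hli
    obtain ⟨δ, ⟨hδ1, hδ2⟩, hδ⟩ := (((hev.and hev2).filter_mono nhdsWithin_le_nhds).and
      (self_mem_nhdsWithin (s := Set.Ioi (0 : ℝ)))).exists
    have hδ0 : 0 < δ := hδ
    have hmem : ((Function.update l i (l i - δ), t) :
        (Fin n → ℝ) × (Fin n → Fin m → ℝ)) ∈ candSet v s B M := by
      refine ⟨?_, ht, ?_, hf⟩
      · intro k
        by_cases hk : k = i
        · subst hk
          have := (hl k).2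
          simp only [Function.update_self]
          constructor <;> linarith
        · simpa [hk] using hl k
      · intro k g
        by_cases hk : k = i
        · subst hk
          simp only [Function.update_self]
          have hmono : v k g - l k * s k g ≤ v k g - (l k - δ) * s k g := by
            have := mul_nonneg hδ0.le (hs k g)
            linarith
          rcases lt_trichotomy (v k g - l k * s k g) 0 with h | h | h
          · exact ⟨Or.inr (hδ1 g h).le, Or.inl ((hw k g).2.resolve_right (not_le.2 h))⟩
          · exact ⟨Or.inl (le_antisymm (ht k g).2 (hex g h)), Or.inr (h ▸ hmono)⟩
          · exact ⟨Or.inl ((hw k g).1.resolve_right (not_le.2 h)),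
              Or.inr (h.le.trans hmono)⟩
        · simpa [hk] using hw k g
    have h1 : ∑ i, l i - ∑ i, ∑ g, t i g ≤
        ∑ k, Function.update l i (l i - δ) k - ∑ i, ∑ g, t i g := hmin hmem
    have h2 : ∑ k, Function.update l i (l i - δ) k < ∑ k, l k := by
      refine Finset.sum_lt_sum (fun k _ => ?_) ⟨i, Finset.mem_univ _, ?_⟩
      · by_cases hk : k = i
        · subst hk; simp [hδ0.le]
        · simp [hk]
      · simp [hδ0]
    linarith

/-- Under generalized assignment constraints (agent-specific sizes `s i g ≥ 0`
and budgets `B i ≥ 0`) and additive valuations with nonnegative values `v i g`, an FEF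
allocation always exists. -/
theorem fef_exists_gap (n m : ℕ)
    (v s : Fin n → Fin m → ℝ) (B : Fin n → ℝ)
    (hv : ∀ i g, 0 ≤ v i g) (hs : ∀ i g, 0 ≤ s i g) (hB : ∀ i, 0 ≤ B i) :
    ∃ x : Fin n → Fin m → ℝ,
      (∀ i g, 0 ≤ x i g ∧ x i g ≤ 1) ∧
      (∀ g, ∑ i, x i g ≤ 1) ∧
      (∀ i, ∑ g, s i g * x i g ≤ B i) ∧
      (∀ i j, i ≠ j → ∀ y : Fin m → ℝ,
        (∀ g, 0 ≤ y g ∧ y g ≤ x j g) → (∑ g, s i g * y g ≤ B i) →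
        ∑ g, y g * v i g ≤ ∑ g, x i g * v i g) ∧
      (∀ i, ∀ y : Fin m → ℝ,
        (∀ g, 0 ≤ y g ∧ y g ≤ 1 - ∑ k, x k g) → (∑ g, s i g * y g ≤ B i) →
        ∑ g, y g * v i g ≤ ∑ g, x i g * v i g) := by
  obtain ⟨M, ⟨l, t⟩, ⟨hl, ht, hw, hf⟩, hcs⟩ := exists_complementary v s B hv hs hB
  dsimp only at hl ht hw hf hcs
  have hsum : ∀ g, ∑ i, shr t i g = (∑ i, t i g) / max 1 (∑ i, t i g) := by
    intro g
    simp only [shr, Finset.sum_div]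
  have hx0 : ∀ i g, 0 ≤ shr t i g := fun i g => div_nonneg (ht i g).1 (max_pos_shr _).le
  -- key comparison
  have key : ∀ i, ∀ y : Fin m → ℝ,
      (∀ g, y g * (v i g - l i * s i g) ≤ shr t i g * (v i g - l i * s i g)) →
      (∑ g, s i g * y g ≤ B i) → ∑ g, y g * v i g ≤ ∑ g, shr t i g * v i g := by
    intro i y h hy
    have h1 := Finset.sum_le_sum (s := Finset.univ) fun g _ => h g
    have e : ∀ z : Fin m → ℝ, ∑ g, z g * (v i g - l i * s i g) =
        ∑ g, z g * v i g - l i * ∑ g, s i g * z g := by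
      intro z
      rw [Finset.mul_sum, ← Finset.sum_sub_distrib]
      exact Finset.sum_congr rfl fun g _ => by ring
    rw [e, e] at h1
    rcases (hl i).1.eq_or_lt with h0 | h0
    · rw [← h0] at h1; linarith
    · have h2 := hcs i h0
      rw [h2] at h1
      have := mul_le_mul_of_nonneg_left hy h0.le
      linarith
  have hneg : ∀ i g, v i g - l i * s i g < 0 → shr t i g = 0 := by
    intro i g h
    simp [shr, (hw i g).2.resolve_right (not_le.2 h)]
  refine ⟨shr t, ?_, ?_, hf, ?_, ?_⟩
  · intro i g
    refine ⟨hx0 i g, ?_⟩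
    exact (div_le_one (max_pos_shr _)).2 ((ht i g).2.trans (le_max_left _ _))
  · intro g
    rw [hsum]
    exact (div_le_one (max_pos_shr _)).2 (le_max_right _ _)
  · intro i j _ y hy hyB
    refine key i y (fun g => ?_) hyB
    rcases le_or_gt (v i g - l i * s i g) 0 with h | h
    · rcases h.eq_or_lt with h | h
      · simp [h]
      · rw [hneg i g h, zero_mul]
        exact mul_nonpos_of_nonneg_of_nonpos (hy g).1 h.le
    · refine mul_le_mul_of_nonneg_right ((hy g).2.trans ?_) h.le
      have h1 := (hw i g).1.resolve_right (not_le.2 h)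
      simp only [shr]
      rw [h1]
      exact div_le_div_of_nonneg_right (ht j g).2 (max_pos_shr _).le
  · intro i y hy hyB
    refine key i y (fun g => ?_) hyB
    rcases le_or_gt (v i g - l i * s i g) 0 with h | h
    · rcases h.eq_or_lt with h | h
      · simp [h]
      · rw [hneg i g h, zero_mul]
        exact mul_nonpos_of_nonneg_of_nonpos (hy g).1 h.le
    · refine mul_le_mul_of_nonneg_right ((hy g).2.trans ?_) h.le
      have h1 := (hw i g).1.resolve_right (not_le.2 h)
      have h2 : 1 ≤ ∑ k, t k g := by
        rw [← h1]
        exact Finset.single_le_sum (f := fun k => t k g) (fun k _ => (ht k g).1)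
          (Finset.mem_univ i)
      have h3 : ∑ k, shr t k g = 1 := by
        rw [hsum, max_eq_right h2, div_self (by linarith)]
      rw [h3, sub_self]
      exact hx0 i g
end

section
/- The set of FEF allocations can fail to be convex. Concretely, consider the instance with 2 agents and 2 goods in which agent 1 has values v_{1,1} = 2, v_{1,2} = 1 and sizes s_{1,1} = s_{1,2} = 1, agent 2 has values v_{2,1} = v_{2,2} = 1 and sizes s_{2,1} = 1, s_{2,2} = 2, and both budgets equal 1. Then: (i) the allocation x with x_1 = (0,1) and x_2 = (1/2, 0) is a feasible FEF allocation; (ii) the allocation y with y_1 = (1/2, 0) and y_2 = (1/2, 0) is a feasible FEF allocation; but (iii) the midpoint allocation z = (x + y)/2, i.e., z_1 = (1/4, 1/2) and z_2 = (1/2, 0), is not FEF (agent 2 feasibly envies agent 1). -/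
open Finset

/-- Values in the non-convexity instance: agent 1 (index 0) values `(2,1)`,
agent 2 (index 1) values `(1,1)`. -/
def ncVal : Fin 2 → Fin 2 → ℝ := ![![2, 1], ![1, 1]]

/-- Sizes in the non-convexity instance: agent 1 has sizes `(1,1)`, agent 2 sizes `(1,2)`. -/
def ncSize : Fin 2 → Fin 2 → ℝ := ![![1, 1], ![1, 2]]

/-- Both budgets equal 1. -/
def ncBudget : Fin 2 → ℝ := fun _ => 1

/-- An allocation of the instance: entries in `[0,1]`, goods not over-allocated,
and each agent's bundle within her budget. -/
def ncFeasible (x : Fin 2 → Fin 2 → ℝ) : Prop :=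
  (∀ i g, 0 ≤ x i g ∧ x i g ≤ 1) ∧
  (∀ g, ∑ i, x i g ≤ 1) ∧
  (∀ i, ∑ g, ncSize i g * x i g ≤ ncBudget i)

/-- Feasible envy-freeness for the non-convexity instance: the allocation is feasible and
no agent feasibly envies the other agent or the charity. -/
def ncFEF (x : Fin 2 → Fin 2 → ℝ) : Prop :=
  ncFeasible x ∧
  (∀ i j : Fin 2, i ≠ j → ∀ y : Fin 2 → ℝ,
    (∀ g, 0 ≤ y g ∧ y g ≤ x j g) → (∑ g, ncSize i g * y g ≤ ncBudget i) →
    ∑ g, y g * ncVal i g ≤ ∑ g, x i g * ncVal i g) ∧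
  (∀ i : Fin 2, ∀ y : Fin 2 → ℝ,
    (∀ g, 0 ≤ y g ∧ y g ≤ 1 - ∑ k, x k g) → (∑ g, ncSize i g * y g ≤ ncBudget i) →
    ∑ g, y g * ncVal i g ≤ ∑ g, x i g * ncVal i g)

/-- the space of FEF allocations can fail to be convex: `x` and `y` below are
both FEF, but their midpoint `z` is not (agent 2 feasibly envies agent 1 in `z`). -/
theorem fef_not_convex :
    ncFEF ![![0, 1], ![1/2, 0]] ∧
    ncFEF ![![1/2, 0], ![1/2, 0]] ∧
    (¬ ncFEF (fun i g => ((![![0, 1], ![1/2, 0]] : Fin 2 → Fin 2 → ℝ) i g +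
        (![![1/2, 0], ![1/2, 0]] : Fin 2 → Fin 2 → ℝ) i g) / 2)) ∧
    -- in the midpoint allocation `z`, agent 2 feasibly envies agent 1:
    (∃ y : Fin 2 → ℝ,
      (∀ g, 0 ≤ y g ∧ y g ≤ ((![![0, 1], ![1/2, 0]] : Fin 2 → Fin 2 → ℝ) 0 g +
          (![![1/2, 0], ![1/2, 0]] : Fin 2 → Fin 2 → ℝ) 0 g) / 2) ∧
      (∑ g, ncSize 1 g * y g ≤ ncBudget 1) ∧
      ∑ g, (((![![0, 1], ![1/2, 0]] : Fin 2 → Fin 2 → ℝ) 1 g +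
          (![![1/2, 0], ![1/2, 0]] : Fin 2 → Fin 2 → ℝ) 1 g) / 2) * ncVal 1 g <
        ∑ g, y g * ncVal 1 g) := by
  have key : ∃ y : Fin 2 → ℝ,
      (∀ g, 0 ≤ y g ∧ y g ≤ ((![![0, 1], ![1/2, 0]] : Fin 2 → Fin 2 → ℝ) 0 g +
          (![![1/2, 0], ![1/2, 0]] : Fin 2 → Fin 2 → ℝ) 0 g) / 2) ∧
      (∑ g, ncSize 1 g * y g ≤ ncBudget 1) ∧
      ∑ g, (((![![0, 1], ![1/2, 0]] : Fin 2 → Fin 2 → ℝ) 1 g +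
          (![![1/2, 0], ![1/2, 0]] : Fin 2 → Fin 2 → ℝ) 1 g) / 2) * ncVal 1 g <
        ∑ g, y g * ncVal 1 g := by
    refine ⟨![1/4, 3/8], ?_, ?_, ?_⟩
    · intro g
      fin_cases g <;> norm_num
    · norm_num [Fin.sum_univ_two, ncSize, ncBudget]
    · norm_num [Fin.sum_univ_two, ncVal]
  refine ⟨?_, ?_, ?_, key⟩
  · refine ⟨⟨?_, ?_, ?_⟩, ?_, ?_⟩
    · intro i g
      fin_cases i <;> fin_cases g <;> norm_num
    · intro g
      fin_cases g <;> norm_num [Fin.sum_univ_two]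
    · intro i
      fin_cases i <;> norm_num [Fin.sum_univ_two, ncSize, ncBudget]
    · intro i j hij y hy hb
      have h0 := hy 0
      have h1 := hy 1
      fin_cases i <;> fin_cases j <;>
        simp [Fin.sum_univ_two, ncSize, ncBudget, ncVal] at * <;> linarith
    · intro i y hy hb
      have h0 := hy 0
      have h1 := hy 1
      fin_cases i <;>
        norm_num [Fin.sum_univ_two, ncSize, ncBudget, ncVal] at * <;> linarith
  · refine ⟨⟨?_, ?_, ?_⟩, ?_, ?_⟩
    · intro i g
      fin_cases i <;> fin_cases g <;> norm_num
    · intro g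
      fin_cases g <;> norm_num [Fin.sum_univ_two]
    · intro i
      fin_cases i <;> norm_num [Fin.sum_univ_two, ncSize, ncBudget]
    · intro i j hij y hy hb
      have h0 := hy 0
      have h1 := hy 1
      fin_cases i <;> fin_cases j <;>
        simp [Fin.sum_univ_two, ncSize, ncBudget, ncVal] at * <;> linarith
    · intro i y hy hb
      have h0 := hy 0
      have h1 := hy 1
      fin_cases i <;>
        norm_num [Fin.sum_univ_two, ncSize, ncBudget, ncVal] at * <;> linarith
  · intro h
    obtain ⟨y, h1, h2, h3⟩ := key
    exact absurd (h.2.1 1 0 (by decide) y h1 h2) (not_le.mpr h3)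
end

section
/- Acyclicity of the envy graph at welfare maximizers: let w ∈ ℝ^n be a weight vector with w_i > 0 for every agent i, and let x be a feasible allocation maximizing ∑_{i=1}^n w_i · v_i(x_i) over all feasible allocations. Then the envy graph of x is acyclic: there is no finite sequence of agents i_1, i_2, …, i_c with c ≥ 1 such that i_j feasibly envies i_{j+1} for every j ∈ {1,…,c−1} and i_c feasibly envies i_1. -/
open Finset

/-- Agent `i` feasibly envies agent `j` under allocation `x`: there is a bundle `y` with
`0 ≤ y ≤ x j` componentwise, feasible for `i` (i.e. `y ∈ F i`), whose (additive) value to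
`i` exceeds that of her own bundle. -/
def FEnvies {n m : ℕ} (v : Fin n → Fin m → ℝ) (F : Fin n → Set (Fin m → ℝ))
    (x : Fin n → Fin m → ℝ) (i j : Fin n) : Prop :=
  ∃ y : Fin m → ℝ, (∀ g, 0 ≤ y g ∧ y g ≤ x j g) ∧ y ∈ F i ∧
    ∑ g, x i g * v i g < ∑ g, y g * v i g

/-- the envy graph of any feasible allocation maximizing weighted social
welfare (with all weights positive) is acyclic: there is no sequence of agents
`p 0, p 1, …, p (c-1)` (with `c ≥ 1`) such that `p j` feasibly envies `p (j+1)` for all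
`j < c - 1` and `p (c-1)` feasibly envies `p 0`. -/
theorem envy_graph_acyclic_at_welfare_max (n m : ℕ)
    (v : Fin n → Fin m → ℝ) (hv : ∀ i g, 0 ≤ v i g)
    (F : Fin n → Set (Fin m → ℝ))
    (w : Fin n → ℝ) (hw : ∀ i, 0 < w i)
    (x : Fin n → Fin m → ℝ)
    (hxbox : ∀ i g, 0 ≤ x i g ∧ x i g ≤ 1)
    (hxsum : ∀ g, ∑ i, x i g ≤ 1)
    (hxF : ∀ i, x i ∈ F i)
    (hmax : ∀ x' : Fin n → Fin m → ℝ,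
      (∀ i g, 0 ≤ x' i g ∧ x' i g ≤ 1) → (∀ g, ∑ i, x' i g ≤ 1) → (∀ i, x' i ∈ F i) →
      ∑ i, w i * (∑ g, x' i g * v i g) ≤ ∑ i, w i * (∑ g, x i g * v i g)) :
    ¬ ∃ (c : ℕ) (p : ℕ → Fin n), 0 < c ∧
      (∀ j, j < c - 1 → FEnvies v F x (p j) (p (j + 1))) ∧
      FEnvies v F x (p (c - 1)) (p 0) := by
  classical
  rintro ⟨c, p, hc, hp, hlast⟩
  -- the agents on the closed walk; each of them envies another one of them
  let S : Set (Fin n) := {i | ∃ j, j < c ∧ p j = i}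
  have hout : ∀ i, ∃ j, i ∈ S → j ∈ S ∧ FEnvies v F x i j := by
    intro i
    by_cases hi : i ∈ S
    · obtain ⟨j, hj, rfl⟩ := hi
      by_cases hj' : j < c - 1
      · exact ⟨p (j + 1), fun _ => ⟨⟨j + 1, by omega, rfl⟩, hp j hj'⟩⟩
      · have : j = c - 1 := by omega
        subst this
        exact ⟨p 0, fun _ => ⟨⟨0, hc, rfl⟩, hlast⟩⟩
    · exact ⟨i, fun h => absurd h hi⟩
  choose f hf using hout
  have hy : ∀ i, ∃ y : Fin m → ℝ, i ∈ S → (∀ g, 0 ≤ y g ∧ y g ≤ x (f i) g) ∧ y ∈ F i ∧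
      ∑ g, x i g * v i g < ∑ g, y g * v i g := by
    intro i
    by_cases hi : i ∈ S
    · obtain ⟨y, h⟩ := (hf i hi).2
      exact ⟨y, fun _ => h⟩
    · exact ⟨x i, fun h => absurd h hi⟩
  choose y hy using hy
  have hiter : ∀ k, f^[k] (p 0) ∈ S := by
    intro k
    induction k with
    | zero => exact ⟨0, hc, rfl⟩
    | succ k ih =>
      rw [Function.iterate_succ_apply']
      exact (hf _ ih).1
  -- some agent on the walk is periodic for `f`
  obtain ⟨a, haS, haP⟩ : ∃ a, a ∈ S ∧ a ∈ Function.periodicPts f := by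
    obtain ⟨k, l, hkl, he⟩ := Finite.exists_ne_map_eq_of_infinite (fun k : ℕ => f^[k] (p 0))
    have key : ∀ k l : ℕ, k < l → f^[k] (p 0) = f^[l] (p 0) →
        ∃ a, a ∈ S ∧ a ∈ Function.periodicPts f := by
      intro k l h e
      refine ⟨f^[k] (p 0), hiter k, Function.mk_mem_periodicPts (n := l - k) (by omega) ?_⟩
      change f^[l - k] (f^[k] (p 0)) = f^[k] (p 0)
      rw [← Function.iterate_add_apply, Nat.sub_add_cancel h.le, e]
    rcases lt_or_gt_of_ne hkl with h | h
    · exact key k l h he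
    · exact key l k h he.symm
  let P : Set (Fin n) := {i | i ∈ S ∧ i ∈ Function.periodicPts f}
  have hbij := Function.bijOn_periodicPts f
  have hPf : ∀ i, i ∈ P → f i ∈ P := fun i hi => ⟨(hf i hi.1).1, hbij.mapsTo hi.2⟩
  let σ : Fin n → Fin n := fun i => if i ∈ P then f i else i
  have hσ : Function.Injective σ := by
    intro i j hij
    by_cases hi : i ∈ P <;> by_cases hj : j ∈ P <;> simp only [σ, hi, hj, if_true, if_false] at hij
    · exact hbij.injOn hi.2 hj.2 hij
    · exact absurd (hij ▸ hPf i hi) hj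
    · exact absurd (hij ▸ hPf j hj) hi
    · exact hij
  have hσb : Function.Bijective σ := Finite.injective_iff_bijective.mp hσ
  let x' : Fin n → Fin m → ℝ := fun i => if i ∈ P then y i else x i
  have hle : ∀ i g, 0 ≤ x' i g ∧ x' i g ≤ x (σ i) g := by
    intro i g
    by_cases hi : i ∈ P
    · simpa only [x', σ, hi, if_true] using (hy i hi.1).1 g
    · simpa only [x', σ, hi, if_false] using ⟨(hxbox i g).1, le_refl (x i g)⟩
  have hF' : ∀ i, x' i ∈ F i := by
    intro i
    by_cases hi : i ∈ P
    · simpa only [x', hi, if_true] using (hy i hi.1).2.1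
    · simpa only [x', hi, if_false] using hxF i
  have hlt : ∀ i, i ∈ P → w i * (∑ g, x i g * v i g) < w i * (∑ g, x' i g * v i g) := by
    intro i hi
    refine mul_lt_mul_of_pos_left ?_ (hw i)
    simpa only [x', hi, if_true] using (hy i hi.1).2.2
  have hcontra := hmax x' (fun i g => ⟨(hle i g).1, (hle i g).2.trans (hxbox _ g).2⟩)
    (fun g => (Finset.sum_le_sum fun i _ => (hle i g).2).trans
      ((hσb.sum_comp (fun i => x i g)).le.trans (hxsum g))) hF'
  refine absurd hcontra (not_le.mpr (Finset.sum_lt_sum (fun i _ => ?_)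
    ⟨a, Finset.mem_univ a, hlt a ⟨haS, haP⟩⟩))
  by_cases hi : i ∈ P
  · exact (hlt i hi).le
  · simp only [x', hi, if_false, le_refl]
end

section
/- Small relative weight precludes being envied: assume all values v_{i,g} > 0 and all sizes s_{i,g} > 0, and let γ > 0 satisfy (1) γ ≤ 1/2; (2) γ < v_{i,g} / v_{h,g} for all agents i, h and goods g; (3) for all agents i, h and goods g, g' with v_{i,g'}/s_{i,g'} > v_{i,g}/s_{i,g}, γ < (1/2) · (v_{i,g'} − v_{i,g} · s_{i,g'}/s_{i,g}) / v_{h,g'}. Let w ∈ ℝ^n have w_i > 0 for all i, and let x be a feasible allocation maximizing ∑_{i=1}^n w_i · v_i(x_i) over all feasible allocations. If agents i and h satisfy w_h ≤ γ · w_i, then agent i does not feasibly envy agent h under x. -/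
open Finset

/-- Small relative weight precludes being envied. With all values and sizes
positive, a sufficiently small `γ > 0` (satisfying the three stated constraints), positive
weights `w`, and a feasible allocation `x` maximizing weighted social welfare under the
generalized assignment constraints, if `w h ≤ γ * w i` then agent `i` does not feasibly
envy agent `h`. -/
theorem small_weight_not_envied (n m : ℕ)
    (v s : Fin n → Fin m → ℝ) (B : Fin n → ℝ)
    (hv : ∀ i g, 0 < v i g) (hs : ∀ i g, 0 < s i g) (hB : ∀ i, 0 ≤ B i)
    (γ : ℝ) (hγpos : 0 < γ)
    (hγ1 : γ ≤ 1 / 2)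
    (hγ2 : ∀ (i h : Fin n) (g : Fin m), γ < v i g / v h g)
    (hγ3 : ∀ (i h : Fin n) (g g' : Fin m),
      v i g / s i g < v i g' / s i g' →
      γ < (1 / 2) * (v i g' - v i g * (s i g' / s i g)) / v h g')
    (w : Fin n → ℝ) (hw : ∀ i, 0 < w i)
    (x : Fin n → Fin m → ℝ)
    (hxbox : ∀ i g, 0 ≤ x i g ∧ x i g ≤ 1)
    (hxsum : ∀ g, ∑ i, x i g ≤ 1)
    (hxfeas : ∀ i, ∑ g, s i g * x i g ≤ B i)
    (hmax : ∀ x' : Fin n → Fin m → ℝ,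
      (∀ i g, 0 ≤ x' i g ∧ x' i g ≤ 1) → (∀ g, ∑ i, x' i g ≤ 1) →
      (∀ i, ∑ g, s i g * x' i g ≤ B i) →
      ∑ i, w i * (∑ g, x' i g * v i g) ≤ ∑ i, w i * (∑ g, x i g * v i g))
    (i h : Fin n) (hwh : w h ≤ γ * w i) :
    ¬ ∃ y : Fin m → ℝ,
      (∀ g, 0 ≤ y g ∧ y g ≤ x h g) ∧ (∑ g, s i g * y g ≤ B i) ∧
      ∑ g, x i g * v i g < ∑ g, y g * v i g := by
  rintro ⟨y, hy, hyB, hlt⟩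
  have hih : i ≠ h := by
    rintro rfl
    nlinarith [hw i]
  have key : ∀ p q : Fin m → ℝ, (∀ g, 0 ≤ p g) → (∀ g, 0 ≤ q g) →
      (∀ g, p g + q g ≤ x i g + x h g) → (∑ g, s i g * p g ≤ B i) → (∑ g, s h g * q g ≤ B h) →
      w i * (∑ g, p g * v i g) + w h * (∑ g, q g * v h g) ≤
        w i * (∑ g, x i g * v i g) + w h * (∑ g, x h g * v h g) := by
    intro p q hp hq hpq hpB hqB
    have split : ∀ f : Fin n → ℝ, ∑ k, f k = f i + (f h + ∑ k ∈ (univ.erase i).erase h, f k) := by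
      intro f
      rw [Finset.add_sum_erase _ _ (by simp [hih.symm]), Finset.add_sum_erase _ _ (by simp)]
    set x' : Fin n → Fin m → ℝ := fun k => if k = i then p else if k = h then q else x k with hx'
    have e1 : x' i = p := by simp [hx']
    have e2 : x' h = q := by simp [hx', hih.symm]
    have e3 : ∀ k, k ≠ i → k ≠ h → x' k = x k := by
      intro k h1 h2
      simp [hx', h1, h2]
    have hnn : ∀ k g, 0 ≤ x' k g := by
      intro k g
      by_cases h1 : k = i
      · rw [h1, e1]; exact hp g
      by_cases h2 : k = h
      · rw [h2, e2]; exact hq g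
      rw [e3 k h1 h2]; exact (hxbox k g).1
    have hsum : ∀ g, ∑ k, x' k g ≤ 1 := by
      intro g
      have h1 := hxsum g
      rw [split] at h1 ⊢
      have h2 : ∑ k ∈ (univ.erase i).erase h, x' k g = ∑ k ∈ (univ.erase i).erase h, x k g := by
        apply Finset.sum_congr rfl
        intro k hk
        simp only [Finset.mem_erase] at hk
        rw [e3 k hk.2.1 hk.1]
      rw [h2, e1, e2]
      linarith [hpq g]
    have hm := hmax x' (fun k g => ⟨hnn k g,
        (Finset.single_le_sum (f := fun k => x' k g) (fun k _ => hnn k g)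
          (Finset.mem_univ k)).trans (hsum g)⟩) hsum (by
      intro k
      by_cases h1 : k = i
      · rw [h1, e1]; exact hpB
      by_cases h2 : k = h
      · rw [h2, e2]; exact hqB
      rw [e3 k h1 h2]; exact hxfeas k)
    rw [split, split (fun k => w k * (∑ g, x k g * v k g))] at hm
    have h2 : ∑ k ∈ (univ.erase i).erase h, w k * (∑ g, x' k g * v k g)
        = ∑ k ∈ (univ.erase i).erase h, w k * (∑ g, x k g * v k g) := by
      apply Finset.sum_congr rfl
      intro k hk
      simp only [Finset.mem_erase] at hk
      rw [e3 k hk.2.1 hk.1]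
    rw [h2, e1, e2] at hm
    linarith
  have key2 : ∀ (g g' : Fin m) (ε δ : ℝ), 0 ≤ ε → 0 ≤ δ → δ ≤ x i g → ε ≤ x h g' →
      s i g' * ε - s i g * δ ≤ B i - ∑ a, s i a * x i a →
      w i * (v i g' * ε - v i g * δ) ≤ w h * (v h g' * ε) := by
    intro g g' ε δ hε hδ hδx hεx hsz
    have E1 : ∀ f z : Fin m → ℝ, ∑ a, f a * (z a + (if a = g' then ε else 0) - (if a = g then δ else 0))
        = ∑ a, f a * z a + f g' * ε - f g * δ := by
      intro f z
      simp [mul_sub, mul_add, Finset.sum_add_distrib, Finset.sum_sub_distrib]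
    have E2 : ∀ f z : Fin m → ℝ, ∑ a, f a * (z a - (if a = g' then ε else 0))
        = ∑ a, f a * z a - f g' * ε := by
      intro f z
      simp [mul_sub, Finset.sum_sub_distrib]
    have := key (fun a => x i a + (if a = g' then ε else 0) - (if a = g then δ else 0))
      (fun a => x h a - (if a = g' then ε else 0)) ?_ ?_ ?_ ?_ ?_
    · simp only [mul_comm _ (v i _), mul_comm _ (v h _)] at this
      rw [E1, E2] at this
      linarith
    · intro a
      have := (hxbox i a).1
      split_ifs <;> subst_vars <;> linarith
    · intro a
      have := (hxbox h a).1
      split_ifs <;> subst_vars <;> linarith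
    · intro a
      split_ifs <;> linarith
    · rw [E1]; linarith
    · rw [E2]
      have := mul_nonneg (hs h g').le hε
      linarith [hxfeas h]
  have vx0 : 0 ≤ ∑ g, x i g * v i g :=
    Finset.sum_nonneg (fun g _ => mul_nonneg (hxbox i g).1 (hv i g).le)
  rcases (hxfeas i).lt_or_eq with hslack | htight
  · obtain ⟨g, -, hg⟩ : ∃ g ∈ (univ : Finset (Fin m)), 0 < y g * v i g := by
      by_contra hcon
      push Not at hcon
      linarith [Finset.sum_nonpos hcon]
    have hyg : 0 < y g := pos_of_mul_pos_left hg (hv i g).le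
    set D := B i - ∑ a, s i a * x i a with hD
    have hDpos : 0 < D := by linarith
    have hεpos : 0 < min (x h g) (D / s i g) :=
      lt_min (hyg.trans_le (hy g).2) (div_pos hDpos (hs i g))
    have hk := key2 g g (min (x h g) (D / s i g)) 0 hεpos.le le_rfl (hxbox i g).1
      (min_le_left _ _) (by
        have h1 := mul_le_mul_of_nonneg_left (min_le_right (x h g) (D / s i g)) (hs i g).le
        rw [mul_div_cancel₀ _ (hs i g).ne'] at h1
        linarith)
    set ε := min (x h g) (D / s i g)
    have h2 := hγ2 i h g
    rw [lt_div_iff₀ (hv h g)] at h2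
    have h3 : w h * v h g ≤ γ * w i * v h g := mul_le_mul_of_nonneg_right hwh (hv h g).le
    have h4 : w i * (γ * v h g) < w i * v i g := mul_lt_mul_of_pos_left h2 (hw i)
    have h5 : (w h * v h g) * ε < (w i * v i g) * ε := mul_lt_mul_of_pos_right (by linarith) hεpos
    linarith
  · obtain ⟨g, g', hxg, hyg, hd⟩ : ∃ g g', 0 < x i g ∧ 0 < y g' ∧
        v i g * s i g' < v i g' * s i g := by
      by_contra hcon
      push Not at hcon
      have hmul : (∑ a, y a * v i a) * (∑ b, s i b * x i b)
          ≤ (∑ a, s i a * y a) * (∑ b, x i b * v i b) := by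
        rw [Finset.sum_mul_sum, Finset.sum_mul_sum]
        apply Finset.sum_le_sum
        intro a _
        apply Finset.sum_le_sum
        intro b _
        rcases (hy a).1.lt_or_eq with h1 | h1
        · rcases (hxbox i b).1.lt_or_eq with h2 | h2
          · have := mul_le_mul_of_nonneg_left (hcon b a h2 h1) (mul_pos h1 h2).le
            linarith
          · simp [← h2]
        · simp [← h1]
      rw [htight] at hmul
      rcases (hB i).lt_or_eq with hBp | hB0
      · have h1 := mul_le_mul_of_nonneg_right hyB vx0
        have h2 := mul_lt_mul_of_pos_left hlt hBp
        linarith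
      · have hnn : ∀ a ∈ (univ : Finset (Fin m)), 0 ≤ s i a * y a :=
          fun a _ => mul_nonneg (hs i a).le (hy a).1
        have h0 := (Finset.sum_eq_zero_iff_of_nonneg hnn).1
          (le_antisymm (by rw [hB0]; exact hyB) (Finset.sum_nonneg hnn))
        have hz : ∑ a, y a * v i a = 0 := by
          apply Finset.sum_eq_zero
          intro a ha
          have := (mul_eq_zero.1 (h0 a ha)).resolve_left (hs i a).ne'
          simp [this]
        linarith
    have hr : 0 < s i g' / s i g := div_pos (hs i g') (hs i g)
    have hεpos : 0 < min (x h g') (x i g / (s i g' / s i g)) :=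
      lt_min (hyg.trans_le (hy g').2) (div_pos hxg hr)
    have hle := mul_le_mul_of_nonneg_right (min_le_right (x h g') (x i g / (s i g' / s i g))) hr.le
    rw [div_mul_cancel₀ _ hr.ne'] at hle
    have hle' := min_le_left (x h g') (x i g / (s i g' / s i g))
    set ε := min (x h g') (x i g / (s i g' / s i g))
    have hsr : s i g * (s i g' / s i g) = s i g' := mul_div_cancel₀ _ (hs i g).ne'
    have h3 := hγ3 i h g g' (by rw [div_lt_div_iff₀ (hs i g) (hs i g')]; exact hd)
    set r := s i g' / s i g
    have hk := key2 g g' ε (ε * r) hεpos.le (mul_pos hεpos hr).le hle hle' (by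
      rw [htight, ← hsr]; apply le_of_eq; ring)
    rw [lt_div_iff₀ (hv h g')] at h3
    have h4 : w h * v h g' ≤ γ * w i * v h g' := mul_le_mul_of_nonneg_right hwh (hv h g').le
    have h5 : 0 < v i g' - v i g * r := by
      have := mul_pos hγpos (hv h g')
      linarith
    have h6 : w i * (γ * v h g') < w i * (v i g' - v i g * r) :=
      mul_lt_mul_of_pos_left (by linarith) (hw i)
    have h7 : (w h * v h g') * ε < (w i * (v i g' - v i g * r)) * ε :=
      mul_lt_mul_of_pos_right (by linarith) hεpos
    linarith
end

section
/- Existence of a compatible weight vector for acyclic envy graphs: let γ ∈ (0,1) and set ε = γ^n / n. If x is an allocation whose envy graph is acyclic (there is no directed cycle of feasible envy among the agents), then there exists a weight vector w ∈ ℝ^n with ∑_{i=1}^n w_i = 1, w_i ≥ ε for every agent i, and such that whenever agent i feasibly envies agent h under x, it holds that w_h ≤ γ · w_i. -/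
open Finset

theorem path_of_transGen {α : Type*} {R : α → α → Prop} {a b : α}
    (h : Relation.TransGen R a b) :
    ∃ (c : ℕ) (p : ℕ → α), p 0 = a ∧ (∀ j, j < c → R (p j) (p (j + 1))) ∧ R (p c) b := by
  induction h using Relation.TransGen.head_induction_on with
  | single h => exact ⟨0, fun _ => _, rfl, by simp, h⟩
  | head h htail ih =>
    rename_i a' c'
    obtain ⟨c, p, h0, hp, hc⟩ := ih
    refine ⟨c + 1, fun k => Nat.casesOn k a' p, rfl, ?_, hc⟩
    intro j hj
    cases j with
    | zero => simpa [h0] using h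
    | succ j => exact hp j (by omega)

/-- existence of a compatible weight vector for acyclic envy graphs: for
`γ ∈ (0,1)` and `ε = γ^n / n`, if the envy graph of allocation `x` is acyclic then there is
a weight vector `w` with `∑ i, w i = 1`, `w i ≥ ε` for all `i`, and `w h ≤ γ * w i`
whenever `i` feasibly envies `h`. -/
theorem compatible_weights_of_acyclic_envy_graph (n m : ℕ) (hn : 0 < n)
    (v : Fin n → Fin m → ℝ) (hv : ∀ i g, 0 ≤ v i g)
    (F : Fin n → Set (Fin m → ℝ))
    (γ : ℝ) (hγpos : 0 < γ) (hγlt : γ < 1)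
    (x : Fin n → Fin m → ℝ)
    (hxbox : ∀ i g, 0 ≤ x i g ∧ x i g ≤ 1)
    (hxsum : ∀ g, ∑ i, x i g ≤ 1)
    (hacyclic : ¬ ∃ (c : ℕ) (p : ℕ → Fin n), 0 < c ∧
      (∀ j, j < c - 1 → FEnvies v F x (p j) (p (j + 1))) ∧
      FEnvies v F x (p (c - 1)) (p 0)) :
    ∃ w : Fin n → ℝ,
      (∑ i, w i = 1) ∧
      (∀ i, γ ^ n / n ≤ w i) ∧
      (∀ i h, FEnvies v F x i h → w h ≤ γ * w i) := by
  classical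
  have hirr : ∀ i, ¬ Relation.TransGen (FEnvies v F x) i i := by
    intro i hi
    obtain ⟨c, p, h0, hp, hc⟩ := path_of_transGen hi
    exact hacyclic ⟨c + 1, p, by omega, fun j hj => hp j (by omega), by simpa [h0] using hc⟩
  let A : Fin n → Finset (Fin n) :=
    fun h => Finset.univ.filter (fun k => Relation.TransGen (FEnvies v F x) k h)
  have hle : ∀ i, (A i).card ≤ n := fun i => by simpa using Finset.card_le_univ (A i)
  have hlt : ∀ i h, FEnvies v F x i h → (A i).card + 1 ≤ (A h).card := by
    intro i h e
    refine Finset.card_lt_card (Finset.ssubset_iff_subset_ne.2 ⟨?_, ?_⟩)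
    · intro k hk
      simp only [A, Finset.mem_filter, Finset.mem_univ, true_and] at hk ⊢
      exact hk.tail e
    · intro heq
      have : i ∈ A i := by
        rw [heq]
        simpa [A] using Relation.TransGen.single e
      exact hirr i (by simpa [A] using this)
  have hne : (Finset.univ : Finset (Fin n)).Nonempty := ⟨⟨0, hn⟩, Finset.mem_univ _⟩
  have hS : 0 < ∑ i, γ ^ (A i).card := Finset.sum_pos (fun i _ => pow_pos hγpos _) hne
  have hSn : ∑ i, γ ^ (A i).card ≤ n := by
    calc ∑ i, γ ^ (A i).card ≤ ∑ _i : Fin n, (1 : ℝ) :=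
          Finset.sum_le_sum (fun i _ => pow_le_one₀ hγpos.le hγlt.le)
      _ = n := by simp
  refine ⟨fun i => γ ^ (A i).card / ∑ i, γ ^ (A i).card, ?_, ?_, ?_⟩
  · rw [← Finset.sum_div, div_self hS.ne']
  · intro i
    exact div_le_div₀ (pow_pos hγpos _).le
      (pow_le_pow_of_le_one hγpos.le hγlt.le (hle i)) hS hSn
  · intro i h e
    show γ ^ (A h).card / _ ≤ γ * (γ ^ (A i).card / _)
    rw [← mul_div_assoc, ← pow_succ']
    exact div_le_div_of_nonneg_right (pow_le_pow_of_le_one hγpos.le hγlt.le (hlt i h e)) hS.le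
end

section
/- Under generalized assignment constraints with all values v_{i,g} > 0, all sizes s_{i,g} > 0, and budgets B_i ≥ 0, there always exists a feasible allocation that is simultaneously FEF (no agent feasibly envies any other agent or the charity) and Pareto-optimal among all feasible allocations. -/
open Finset

section BrouwerPart

/-- Metric projection onto a compact convex set. -/
lemma exists_proj {E : Type*} [NormedAddCommGroup E] [InnerProductSpace ℝ E]
    {K : Set E} (hne : K.Nonempty) (hc : IsCompact K) (hK : Convex ℝ K) :
    ∃ P : E → E, (∀ x, P x ∈ K) ∧ (∀ x, ∀ z ∈ K, inner ℝ (x - P x) (z - P x) ≤ 0) ∧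
      LipschitzWith 1 P := by
  have h := exists_norm_eq_iInf_of_complete_convex hne hc.isComplete hK
  choose P hP hP2 using h
  have hP3 : ∀ x, ∀ z ∈ K, inner ℝ (x - P x) (z - P x) ≤ 0 := fun x =>
    (norm_eq_iInf_iff_real_inner_le_zero hK (hP x)).1 (hP2 x)
  refine ⟨P, hP, hP3, ?_⟩
  apply LipschitzWith.of_dist_le_mul
  intro x y
  simp only [NNReal.coe_one, one_mul, dist_eq_norm]
  have h1 := hP3 x (P y) (hP y)
  have h2 := hP3 y (P x) (hP x)
  have h3 : ‖P x - P y‖ ^ 2 ≤ inner ℝ (x - y) (P x - P y) := by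
    rw [← real_inner_self_eq_norm_sq]
    have e : inner ℝ (x - y) (P x - P y) - inner ℝ (P x - P y) (P x - P y)
        = - inner ℝ (x - P x) (P y - P x) - inner ℝ (y - P y) (P x - P y) := by
      simp only [inner_sub_left, inner_sub_right]; ring
    linarith
  have h4 := real_inner_le_norm (x - y) (P x - P y)
  by_contra hlt
  push Not at hlt
  nlinarith [norm_nonneg (x - y), norm_nonneg (P x - P y)]

/-- Interpolation of `t ↦ det (1 + t A)`. -/
lemma det_interp {E : Type*} [NormedAddCommGroup E] [NormedSpace ℝ E] [FiniteDimensional ℝ E]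
    (t : ℕ → ℝ) (ht : Function.Injective t) :
    ∃ (N : ℕ) (c : ℕ → ℝ), (∑ k ∈ range (N + 1), c k = 1) ∧
      ∀ A : E →L[ℝ] E, (ContinuousLinearMap.id ℝ E + A).det =
        ∑ k ∈ range (N + 1), c k * (ContinuousLinearMap.id ℝ E + t k • A).det := by
  classical
  let b := Module.finBasis ℝ E
  set N := Module.finrank ℝ E
  refine ⟨N, fun k => (Lagrange.basis (range (N + 1)) t k).eval 1, ?_, ?_⟩
  · have := Lagrange.sum_basis (s := range (N + 1)) (v := t) ht.injOn ⟨0, by simp⟩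
    have h2 := congrArg (Polynomial.eval 1) this
    simpa [Polynomial.eval_finsetSum] using h2
  · intro A
    let M : Matrix (Fin N) (Fin N) ℝ := LinearMap.toMatrix b b (A : E →ₗ[ℝ] E)
    let p : Polynomial ℝ := Matrix.det ((Polynomial.X : Polynomial ℝ) • M.map Polynomial.C
      + (1 : Matrix (Fin N) (Fin N) ℝ).map Polynomial.C)
    have hdeg : p.degree < #(range (N + 1)) := by
      have := Polynomial.natDegree_det_X_add_C_le M 1
      rw [card_range]
      refine lt_of_le_of_lt Polynomial.degree_le_natDegree ?_
      have h3 : p.natDegree ≤ N := this.trans (by simp)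
      exact_mod_cast Nat.lt_succ_of_le h3
    have hev : ∀ r : ℝ, p.eval r = (ContinuousLinearMap.id ℝ E + r • A).det := by
      intro r
      have h1 : p.eval r = (r • M + 1).det := by
        simp only [p]
        rw [← Polynomial.coe_evalRingHom, RingHom.map_det]
        congr 1
        ext i j
        by_cases hij : i = j <;> simp [hij] <;> ring
      rw [h1, ContinuousLinearMap.det, ← LinearMap.det_toMatrix b]
      congr 1
      simp [M, add_comm]
    have hi := Lagrange.eq_interpolate_of_eval_eq (s := range (N + 1)) (v := t)
      (fun k => (ContinuousLinearMap.id ℝ E + t k • A).det) ht.injOn hdeg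
      (fun k _ => hev (t k))
    have h5 := congrArg (Polynomial.eval 1) hi
    rw [hev 1, one_smul, Lagrange.interpolate_apply, Polynomial.eval_finsetSum] at h5
    rw [h5]
    refine Finset.sum_congr rfl fun k _ => ?_
    simp [mul_comm]

/-- There is no `C^1` retraction of the ball on the sphere (Milnor, Rogers). -/
lemma no_retraction {E : Type*} [NormedAddCommGroup E] [InnerProductSpace ℝ E]
    [FiniteDimensional ℝ E] [MeasurableSpace E] [BorelSpace E]
    (ρ : ℝ) (hρ : 0 < ρ) (r : E → E) (hr : ContDiff ℝ 1 r) (hn : ∀ x, ‖r x‖ = ρ)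
    (hb : ∀ x, ‖x‖ = ρ → r x = x) : False := by
  set B : Set E := Metric.closedBall 0 ρ with hBdef
  have hBc : IsCompact B := isCompact_closedBall 0 ρ
  have hBconv : Convex ℝ B := convex_closedBall 0 ρ
  have hBne : B.Nonempty := ⟨0, by simp [hBdef, hρ.le]⟩
  have hmemB : ∀ x, x ∈ B ↔ ‖x‖ ≤ ρ := fun x => by simp [hBdef]
  set h : E → E := fun x => r x - x with hh
  have hcd : ContDiff ℝ 1 h := hr.sub contDiff_id
  set D : E → (E →L[ℝ] E) := fun x => fderiv ℝ h x with hD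
  have hDc : Continuous D := hcd.continuous_fderiv one_ne_zero
  have hDiff : Differentiable ℝ h := hcd.differentiable one_ne_zero
  obtain ⟨C0, hC0⟩ := hBc.exists_bound_of_continuousOn hDc.continuousOn
  set C : ℝ := |C0| + 1 with hC
  have hCpos : 0 < C := by positivity
  have hDC : ∀ x ∈ B, ‖D x‖ ≤ C := fun x hx =>
    (hC0 x hx).trans ((le_abs_self _).trans (by simp [hC]))
  have hLip : ∀ x ∈ B, ∀ y ∈ B, ‖h x - h y‖ ≤ C * ‖x - y‖ := fun x hx y hy =>
    hBconv.norm_image_sub_le_of_norm_fderiv_le (fun z _ => hDiff z) hDC hy hx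
  have hh0 : ∀ x, ‖x‖ = ρ → h x = 0 := fun x hx => by simp [hh, hb x hx]
  -- determinant positive near the identity
  obtain ⟨ε, hε, hdet⟩ : ∃ ε > 0, ∀ A : E →L[ℝ] E, ‖A‖ < ε →
      0 < (ContinuousLinearMap.id ℝ E + A).det := by
    have hc : Continuous fun A : E →L[ℝ] E => (ContinuousLinearMap.id ℝ E + A).det :=
      ContinuousLinearMap.continuous_det.comp (continuous_const.add continuous_id)
    have h0 : (0 : ℝ) < (ContinuousLinearMap.id ℝ E + (0 : E →L[ℝ] E)).det := by
      simp [ContinuousLinearMap.det]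
    have := hc.continuousAt.eventually (lt_mem_nhds h0)
    obtain ⟨ε, hε, h1⟩ := Metric.eventually_nhds_iff.1 this
    exact ⟨ε, hε, fun A hA => h1 (by simpa using hA)⟩
  set t0 : ℝ := min (1 / 2) (ε / 2) / C with ht0
  have hmin : 0 < min (1 / 2) (ε / 2) := lt_min (by norm_num) (by linarith)
  have ht0pos : 0 < t0 := div_pos hmin hCpos
  have ht0C : t0 * C = min (1 / 2) (ε / 2) := by rw [ht0]; field_simp
  have ht01 : t0 ≤ 1 := by
    have : t0 * 1 ≤ t0 * C := by
      apply mul_le_mul_of_nonneg_left _ ht0pos.le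
      simp [hC]
    have := min_le_left (1 / 2 : ℝ) (ε / 2)
    linarith
  obtain ⟨P, hPB, hPi, hPL⟩ := exists_proj hBne hBc hBconv
  have hPsph : ∀ x, x ∉ B → ‖P x‖ = ρ := by
    intro x hx
    by_contra hne
    have hlt : ‖P x‖ < ρ := lt_of_le_of_ne ((hmemB _).1 (hPB x)) hne
    have hxP : 0 < ‖x - P x‖ := by
      rw [norm_pos_iff, sub_ne_zero]
      rintro h1
      exact hx (h1 ▸ hPB x)
    set η := (ρ - ‖P x‖) / ‖x - P x‖ with hη
    have hηpos : 0 < η := div_pos (by linarith) hxP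
    have hz : P x + η • (x - P x) ∈ B := by
      rw [hmemB]
      refine (norm_add_le _ _).trans ?_
      rw [norm_smul, Real.norm_of_nonneg hηpos.le, hη, div_mul_cancel₀ _ hxP.ne']
      linarith
    have := hPi x _ hz
    rw [add_sub_cancel_left, real_inner_smul_right, real_inner_self_eq_norm_sq] at this
    have : 0 < η * ‖x - P x‖ ^ 2 := by positivity
    linarith
  have key : ∀ t : ℝ, 0 < t → t ≤ t0 →
      ∫ x in B, (ContinuousLinearMap.id ℝ E + t • D x).det = MeasureTheory.volume.real B := by
    intro t ht htt
    have htC : t * C ≤ min (1 / 2) (ε / 2) := by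
      rw [← ht0C]; exact mul_le_mul_of_nonneg_right htt hCpos.le
    have htC1 : t * C ≤ 1 / 2 := htC.trans (min_le_left _ _)
    have htC2 : t * C ≤ ε / 2 := htC.trans (min_le_right _ _)
    set g : E → E := fun x => x + t • h x with hg
    have hinj : Set.InjOn g B := by
      intro x hx y hy hxy
      have h1 : x - y = t • (h y - h x) := by
        have h2 : x + t • h x = y + t • h y := hxy
        rw [smul_sub]
        rw [sub_eq_sub_iff_add_eq_add, h2]
        abel
      have h2 : ‖x - y‖ ≤ 1 / 2 * ‖x - y‖ := by
        calc ‖x - y‖ = t * ‖h y - h x‖ := by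
              rw [h1, norm_smul, Real.norm_of_nonneg ht.le]
          _ ≤ t * (C * ‖y - x‖) := by gcongr; exact hLip y hy x hx
          _ = (t * C) * ‖x - y‖ := by rw [norm_sub_rev]; ring
          _ ≤ 1 / 2 * ‖x - y‖ := by gcongr
      have h3 : ‖x - y‖ = 0 := le_antisymm (by linarith) (norm_nonneg _)
      exact sub_eq_zero.1 (norm_eq_zero.1 h3)
    have himg : g '' B = B := by
      apply Set.Subset.antisymm
      · rintro _ ⟨x, hx, rfl⟩
        rw [hmemB]
        have e : g x = (1 - t) • x + t • r x := by
          simp only [hg, hh, smul_sub, sub_smul, one_smul]; abel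
        rw [e]
        refine (norm_add_le _ _).trans ?_
        rw [norm_smul, norm_smul, hn, Real.norm_of_nonneg ht.le,
          Real.norm_of_nonneg (by linarith)]
        have := mul_le_mul_of_nonneg_left ((hmemB x).1 hx) (by linarith : 0 ≤ 1 - t)
        linarith
      · intro y hy
        have hcon : ContractingWith (1 / 2) (fun x => y - t • h (P x)) := by
          refine ⟨by rw [← NNReal.coe_lt_coe]; norm_num, ?_⟩
          apply LipschitzWith.of_dist_le_mul
          intro a b
          have hP1 := hPL.dist_le_mul a b
          simp only [NNReal.coe_one, one_mul, dist_eq_norm] at hP1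
          rw [dist_eq_norm, dist_eq_norm]
          calc ‖y - t • h (P a) - (y - t • h (P b))‖ = ‖t • (h (P b) - h (P a))‖ := by
                rw [sub_sub_sub_cancel_left, ← smul_sub]
            _ = t * ‖h (P a) - h (P b)‖ := by
                rw [norm_smul, Real.norm_of_nonneg ht.le, norm_sub_rev]
            _ ≤ t * (C * ‖P a - P b‖) := by gcongr; exact hLip _ (hPB a) _ (hPB b)
            _ ≤ t * (C * ‖a - b‖) := by gcongr
            _ = (t * C) * ‖a - b‖ := by ring
            _ ≤ 1 / 2 * ‖a - b‖ := by gcongr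
            _ = _ := by norm_num
        set x := hcon.fixedPoint with hx
        have hfx : y - t • h (P x) = x := hcon.fixedPoint_isFixedPt
        have hxB : x ∈ B := by
          by_contra hxB
          rw [hh0 _ (hPsph x hxB), smul_zero, sub_zero] at hfx
          exact hxB (hfx ▸ hy)
        have hPx : P x = x := by
          have h1 := hPi x x hxB
          rw [real_inner_self_eq_norm_sq] at h1
          have h2 : ‖x - P x‖ = 0 := by nlinarith [norm_nonneg (x - P x)]
          exact (sub_eq_zero.1 (norm_eq_zero.1 h2)).symm
        refine ⟨x, hxB, ?_⟩
        rw [hPx] at hfx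
        simp only [hg]
        rw [← eq_sub_iff_add_eq]
        exact hfx.symm
    have hder : ∀ x ∈ B, HasFDerivWithinAt g (ContinuousLinearMap.id ℝ E + t • D x) B x :=
      fun x _ => ((hasFDerivAt_id x).add ((hDiff x).hasFDerivAt.const_smul t)).hasFDerivWithinAt
    have hcv := MeasureTheory.integral_image_eq_integral_abs_det_fderiv_smul
      MeasureTheory.volume hBc.measurableSet hder hinj (fun _ => (1 : ℝ))
    rw [himg] at hcv
    simp only [smul_eq_mul, mul_one, MeasureTheory.setIntegral_const] at hcv
    rw [hcv]
    refine MeasureTheory.setIntegral_congr_fun hBc.measurableSet fun x hx => ?_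
    refine (abs_of_pos (hdet _ ?_)).symm
    rw [norm_smul, Real.norm_of_nonneg ht.le]
    have := mul_le_mul_of_nonneg_left (hDC x hx) ht.le
    linarith
  have hzero : ∀ x, (ContinuousLinearMap.id ℝ E + D x).det = 0 := by
    intro x
    have hrd : HasFDerivAt r (ContinuousLinearMap.id ℝ E + D x) x := by
      have h1 := (hasFDerivAt_id (𝕜 := ℝ) x).add (hDiff x).hasFDerivAt
      have h2 : (id + h : E → E) = r := by ext z; simp [hh]
      rwa [h2] at h1
    set A := ContinuousLinearMap.id ℝ E + D x
    have hsq := hrd.norm_sq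
    have hconst : (fun z => ‖r z‖ ^ 2) = fun _ => ρ ^ 2 := by ext z; rw [hn]
    have horth : ∀ u, inner ℝ (r x) (A u) = 0 := by
      intro u
      have h1 : HasFDerivAt (fun z => ‖r z‖ ^ 2) (0 : E →L[ℝ] ℝ) x := by
        rw [hconst]; exact hasFDerivAt_const _ _
      have h2 := congrArg (fun L : E →L[ℝ] ℝ => L u) (hsq.unique h1)
      simpa using h2
    by_contra hne
    have hsurj : Function.Surjective (A : E →ₗ[ℝ] E) :=
      (LinearMap.equivOfDetNeZero (A : E →ₗ[ℝ] E) hne).surjective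
    obtain ⟨u, hu⟩ := hsurj (r x)
    have h3 := horth u
    have hu' : A u = r x := hu
    rw [hu', real_inner_self_eq_norm_sq, hn] at h3
    have : 0 < ρ ^ 2 := by positivity
    linarith
  let tt : ℕ → ℝ := fun k => t0 / (k + 1)
  have htt : Function.Injective tt := by
    intro a b hab
    simp only [tt] at hab
    rw [div_eq_div_iff (by positivity) (by positivity)] at hab
    have := mul_left_cancel₀ ht0pos.ne' hab
    have h2 : (b : ℝ) = a := by linarith
    exact_mod_cast h2.symm
  obtain ⟨N, c, hc1, hc2⟩ := det_interp (E := E) tt htt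
  have hintg : ∀ t : ℝ, MeasureTheory.IntegrableOn
      (fun x => (ContinuousLinearMap.id ℝ E + t • D x).det) B := fun t =>
    (ContinuousLinearMap.continuous_det.comp
      (continuous_const.add (hDc.const_smul t))).continuousOn.integrableOn_compact hBc
  have hfin : ∫ x in B, (ContinuousLinearMap.id ℝ E + D x).det = MeasureTheory.volume.real B := by
    rw [MeasureTheory.integral_congr_ae (Filter.Eventually.of_forall fun x => hc2 (D x))]
    rw [MeasureTheory.integral_finsetSum _ (fun k _ => (hintg (tt k)).const_mul (c k))]
    simp_rw [MeasureTheory.integral_const_mul]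
    have : ∀ k ∈ range (N + 1), c k * ∫ x in B, (ContinuousLinearMap.id ℝ E + tt k • D x).det
        = c k * MeasureTheory.volume.real B := by
      intro k _
      rw [key (tt k) (by positivity) (div_le_self ht0pos.le (by simp))]
    rw [Finset.sum_congr rfl this, ← Finset.sum_mul, hc1, one_mul]
  simp only [hzero, MeasureTheory.integral_zero] at hfin
  have hvol : 0 < MeasureTheory.volume.real B :=
    ENNReal.toReal_pos (Metric.measure_closedBall_pos _ _ hρ).ne' hBc.measure_lt_top.ne
  linarith

/-- The Brouwer theorem for bounded continuous maps. -/
lemma brouwer_bounded {E : Type*} [NormedAddCommGroup E] [InnerProductSpace ℝ E]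
    [FiniteDimensional ℝ E] (G : E → E) (hG : Continuous G) (R : ℝ) (hR : 0 < R)
    (hb : ∀ x, ‖G x‖ ≤ R) : ∃ x, G x = x := by
  by_contra hno
  push Not at hno
  borelize E
  let χ : E → ℝ := fun x => max 0 (min 1 (2 - ‖x‖ / R))
  have hχc : Continuous χ := by fun_prop
  let G1 : E → E := fun x => χ x • G x
  have hG1 : Continuous G1 := hχc.smul hG
  have hχ0 : ∀ x, 0 ≤ χ x := fun x => le_max_left _ _
  have hχ1 : ∀ x, χ x ≤ 1 := fun x => max_le zero_le_one (min_le_left _ _)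
  have hG1ne : ∀ x, x ≠ G1 x := by
    intro x hx
    have h1 : ‖x‖ ≤ R := by
      rw [hx, norm_smul, Real.norm_of_nonneg (hχ0 x)]
      calc χ x * ‖G x‖ ≤ 1 * R :=
            mul_le_mul (hχ1 x) (hb x) (norm_nonneg _) zero_le_one
        _ = R := one_mul R
    have h2 : χ x = 1 := by
      have : ‖x‖ / R ≤ 1 := (div_le_one hR).2 h1
      simp only [χ]
      rw [min_eq_left (by linarith), max_eq_right zero_le_one]
    apply hno x
    simp only [G1, h2, one_smul] at hx
    exact hx.symm
  obtain ⟨g, hg, hga, hgs⟩ := hG1.exists_contDiff_approx 1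
    (ε := fun x => ‖x - G1 x‖) (continuous_id.sub hG1).norm
    (fun x => norm_pos_iff.2 (sub_ne_zero.2 (hG1ne x)))
  have hgne : ∀ x, x - g x ≠ 0 := by
    intro x hx
    have h1 := hga x
    rw [← sub_eq_zero.1 hx, dist_eq_norm] at h1
    exact lt_irrefl _ h1
  have hg0 : ∀ x, ‖x‖ = 2 * R → g x = 0 := by
    intro x hx
    by_contra hne
    have : x ∈ Function.support G1 := hgs hne
    apply this
    have : ‖x‖ / R = 2 := by rw [hx]; field_simp
    simp [G1, χ, this]
  refine no_retraction (2 * R) (by positivity)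
    (fun x => ((2 * R) / ‖x - g x‖) • (x - g x)) ?_ ?_ ?_
  · have hw : ContDiff ℝ 1 fun x => x - g x := contDiff_id.sub hg
    exact (contDiff_const.div (hw.norm ℝ hgne) (fun x => norm_ne_zero_iff.2 (hgne x))).smul hw
  · intro x
    have := norm_pos_iff.2 (hgne x)
    rw [norm_smul, Real.norm_of_nonneg (by positivity), div_mul_cancel₀ _ this.ne']
  · intro x hx
    simp only [hg0 x hx, sub_zero, hx]
    rw [div_self (by positivity), one_smul]

/-- Existence for variational inequalities (Hartman, Stampacchia). -/
lemma exists_vi {E : Type*} [NormedAddCommGroup E] [InnerProductSpace ℝ E]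
    [FiniteDimensional ℝ E] {K : Set E} (hne : K.Nonempty) (hc : IsCompact K) (hK : Convex ℝ K)
    (F : E → E) (hF : Continuous F) :
    ∃ z ∈ K, ∀ z' ∈ K, inner ℝ (F z) (z' - z) ≤ 0 := by
  obtain ⟨P, hPK, hPi, hPL⟩ := exists_proj hne hc hK
  obtain ⟨R, hR⟩ := hc.isBounded.exists_norm_le
  obtain ⟨z, hz⟩ := brouwer_bounded (fun z => P (P z + F (P z)))
    (hPL.continuous.comp (hPL.continuous.add (hF.comp hPL.continuous))) (|R| + 1)
    (by positivity) (fun x => (hR _ (hPK _)).trans ((le_abs_self R).trans (by linarith)))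
  have hzK : z ∈ K := hz ▸ hPK _
  have hPz : P z = z := by
    have h1 := hPi z z hzK
    rw [real_inner_self_eq_norm_sq] at h1
    have h2 : ‖z - P z‖ = 0 := by nlinarith [norm_nonneg (z - P z)]
    exact (sub_eq_zero.1 (norm_eq_zero.1 h2)).symm
  refine ⟨z, hzK, fun z' hz' => ?_⟩
  have h1 := hPi (P z + F (P z)) z' hz'
  rw [hz, hPz, add_sub_cancel_left] at h1
  exact h1

end BrouwerPart

section AllocPart

variable {n m : ℕ}

/-- Feasible allocations. -/
def Feas (s : Fin n → Fin m → ℝ) (B : Fin n → ℝ) (x : Fin n → Fin m → ℝ) : Prop :=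
  (∀ i g, 0 ≤ x i g) ∧ (∀ g, ∑ i, x i g ≤ 1) ∧ ∀ i, ∑ g, s i g * x i g ≤ B i

/-- Agent `i` feasibly envies agent `j`. -/
def Envy (v s : Fin n → Fin m → ℝ) (B : Fin n → ℝ) (x : Fin n → Fin m → ℝ) (i j : Fin n) : Prop :=
  ∃ y : Fin m → ℝ, (∀ g, 0 ≤ y g ∧ y g ≤ x j g) ∧ (∑ g, s i g * y g ≤ B i) ∧
    ∑ g, x i g * v i g < ∑ g, y g * v i g

lemma Feas.le_one {s : Fin n → Fin m → ℝ} {B : Fin n → ℝ} {x : Fin n → Fin m → ℝ}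
    (h : Feas s B x) (i : Fin n) (g : Fin m) : x i g ≤ 1 :=
  (single_le_sum (f := fun i => x i g) (fun k _ => h.1 k g) (mem_univ i)).trans (h.2.1 g)

lemma Envy.ne {v s : Fin n → Fin m → ℝ} {B : Fin n → ℝ} {x : Fin n → Fin m → ℝ}
    (hv : ∀ i g, 0 < v i g) {i j : Fin n} (h : Envy v s B x i j) : i ≠ j := by
  rintro rfl
  obtain ⟨y, hy, -, hlt⟩ := h
  refine absurd hlt (not_lt.2 (sum_le_sum fun g _ => ?_))
  exact mul_le_mul_of_nonneg_right (hy g).2 (hv i g).le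

/-- Swapping along an envy cycle gives a Pareto improvement. -/
lemma cycle_improve {v s : Fin n → Fin m → ℝ} {B : Fin n → ℝ} {x : Fin n → Fin m → ℝ}
    (hx : Feas s B x) (f : Fin n → Fin n) (p : Fin n) (d : ℕ) (hd : 0 < d)
    (hp : f^[d] p = p) (he : ∀ k < d, Envy v s B x (f^[k] p) (f (f^[k] p))) :
    ∃ x', Feas s B x' ∧ (∀ i, ∑ g, x i g * v i g ≤ ∑ g, x' i g * v i g) ∧
      ∃ i, ∑ g, x i g * v i g < ∑ g, x' i g * v i g := by
  classical
  set C : Finset (Fin n) := (range d).image (fun k => f^[k] p) with hC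
  have hCe : ∀ i ∈ C, Envy v s B x i (f i) := by
    intro i hi
    obtain ⟨k, hk, rfl⟩ := mem_image.1 hi
    exact he k (mem_range.1 hk)
  have hCsub : C ⊆ C.image f := by
    intro i hi
    obtain ⟨k, hk, rfl⟩ := mem_image.1 hi
    rw [mem_range] at hk
    rcases k with _ | k
    · refine mem_image.2 ⟨f^[d - 1] p, mem_image.2 ⟨d - 1, by simp; omega, rfl⟩, ?_⟩
      rw [← Function.iterate_succ_apply' f, Nat.succ_eq_add_one, Nat.sub_add_cancel hd, hp]
      rfl
    · refine mem_image.2 ⟨f^[k] p, mem_image.2 ⟨k, by simp; omega, rfl⟩, ?_⟩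
      simp only [Function.iterate_succ_apply' f]
  have hCeq : C.image f = C :=
    (eq_of_subset_of_card_le hCsub card_image_le).symm
  have hinj : Set.InjOn f C := by
    apply Finset.card_image_iff.1
    rw [hCeq]
  choose! Y hY1 hY2 hY3 using hCe
  refine ⟨fun i => if i ∈ C then Y i else x i, ⟨?_, ?_, ?_⟩, ?_, p, ?_⟩
  · intro i g
    by_cases hi : i ∈ C
    · simp only [hi, if_true]; exact (hY1 i hi g).1
    · simp only [hi, if_false]; exact hx.1 i g
  · intro g
    refine le_trans ?_ (hx.2.1 g)
    have h1 : ∑ i ∈ C, x (f i) g = ∑ i ∈ C, x i g := by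
      conv_rhs => rw [← hCeq]
      rw [sum_image hinj]
    rw [← sum_add_sum_compl C, ← sum_add_sum_compl C (fun i => x i g), ← h1]
    apply add_le_add
    · refine sum_le_sum fun i hi => ?_
      simp only [hi, if_true]; exact (hY1 i hi g).2
    · refine sum_le_sum fun i hi => ?_
      rw [mem_compl] at hi
      simp only [hi, if_false]; exact le_rfl
  · intro i
    by_cases hi : i ∈ C
    · simp only [hi, if_true]; exact hY2 i hi
    · simp only [hi, if_false]; exact hx.2.2 i
  · intro i
    by_cases hi : i ∈ C
    · simp only [hi, if_true]; exact (hY3 i hi).le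
    · simp only [hi, if_false]; exact le_rfl
  · have hpC : p ∈ C := mem_image.2 ⟨0, by simpa using hd, rfl⟩
    simp only [hpC, if_true]; exact hY3 p hpC

/-- Two-agent exchange inequality at a weighted optimum. -/
lemma swap_le {v s : Fin n → Fin m → ℝ} {B : Fin n → ℝ} {x : Fin n → Fin m → ℝ}
    (hs : ∀ i g, 0 < s i g)
    (hx : Feas s B x) (lam : Fin n → ℝ)
    (hmax : ∀ x', Feas s B x' →
      ∑ i, lam i * ∑ g, x' i g * v i g ≤ ∑ i, lam i * ∑ g, x i g * v i g)
    {i j : Fin n} (hij : i ≠ j) (p q : Fin m → ℝ) (hp : ∀ g, 0 ≤ p g ∧ p g ≤ x j g)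
    (hq : ∀ g, 0 ≤ q g ∧ q g ≤ x i g)
    (hb : ∑ g, s i g * x i g + ∑ g, s i g * p g - ∑ g, s i g * q g ≤ B i) :
    lam i * (∑ g, p g * v i g - ∑ g, q g * v i g) ≤ lam j * ∑ g, p g * v j g := by
  classical
  have h := hmax (fun k g => x k g + (if k = i then p g - q g else 0) - (if k = j then p g else 0))
    ⟨?_, ?_, ?_⟩
  · have e : ∀ k, lam k * ∑ g, (x k g + (if k = i then p g - q g else 0)
          - (if k = j then p g else 0)) * v k g
        = lam k * ∑ g, x k g * v k g
          + (if k = i then lam i * (∑ g, p g * v i g - ∑ g, q g * v i g) else 0)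
          - (if k = j then lam j * ∑ g, p g * v j g else 0) := by
      intro k
      have : ∑ g, (x k g + (if k = i then p g - q g else 0)
          - (if k = j then p g else 0)) * v k g
        = ∑ g, x k g * v k g
          + (if k = i then (∑ g, p g * v k g - ∑ g, q g * v k g) else 0)
          - (if k = j then ∑ g, p g * v k g else 0) := by
        split_ifs <;> simp [sub_mul, add_mul, sum_add_distrib, sum_sub_distrib]
      rw [this]
      split_ifs with h1 h2 h2
      · subst h1; exact absurd h2 hij
      · subst h1; ring
      · subst h2; ring
      · ring
    simp only [e, sum_add_distrib, sum_sub_distrib, sum_ite_eq', mem_univ, if_true] at h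
    linarith
  · intro k g
    have h1 := hx.1 k g
    have h2 := hp g
    have h3 := hq g
    by_cases hki : k = i
    · subst hki
      simp only [if_true, hij, if_false]; linarith
    · by_cases hkj : k = j
      · subst hkj
        simp only [if_true, hki, if_false]; linarith
      · simp only [hki, hkj, if_false]; linarith
  · intro g
    simp only [sum_add_distrib, sum_sub_distrib, sum_ite_eq', mem_univ, if_true]
    linarith [hx.2.1 g, hq g]
  · intro k
    have h1 := hx.2.2 k
    by_cases hki : k = i
    · subst hki
      simp only [if_true, hij, if_false, mul_add, mul_sub, sum_add_distrib, sum_sub_distrib,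
        mul_zero, sum_const_zero]
      linarith
    · by_cases hkj : k = j
      · subst hkj
        simp only [if_true, hki, if_false, mul_add, mul_sub, sum_add_distrib, sum_sub_distrib,
          mul_zero, sum_const_zero]
        have : 0 ≤ ∑ g, s k g * p g := sum_nonneg fun g _ => mul_nonneg (hs k g).le (hp g).1
        linarith
      · simpa only [hki, hkj, if_false, add_zero, sub_zero] using h1

/-- At a weighted optimum an envied agent has comparable weight. -/
lemma exists_ratio {v s : Fin n → Fin m → ℝ} {B : Fin n → ℝ}
    (hv : ∀ i g, 0 < v i g) (hs : ∀ i g, 0 < s i g) :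
    ∃ K : ℝ, 1 ≤ K ∧ ∀ (lam : Fin n → ℝ) (x : Fin n → Fin m → ℝ), (∀ i, 0 < lam i) →
      Feas s B x → (∀ x', Feas s B x' →
        ∑ i, lam i * ∑ g, x' i g * v i g ≤ ∑ i, lam i * ∑ g, x i g * v i g) →
      ∀ i j, Envy v s B x i j → lam i < K * lam j := by
  classical
  obtain ⟨K1, hK1⟩ := Set.Finite.bddAbove
    (Set.finite_range fun a : Fin n × Fin n × Fin m => v a.2.1 a.2.2 / v a.1 a.2.2)
  obtain ⟨K2, hK2⟩ := Set.Finite.bddAbove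
    (Set.finite_range fun a : Fin n × Fin n × Fin m × Fin m =>
      (v a.2.1 a.2.2.1 / s a.1 a.2.2.1) /
        (v a.1 a.2.2.1 / s a.1 a.2.2.1 - v a.1 a.2.2.2 / s a.1 a.2.2.2))
  have hK1' : ∀ i j g, v j g / v i g ≤ K1 := fun i j g => hK1 ⟨(i, j, g), rfl⟩
  have hK2' : ∀ i j g h, (v j g / s i g) / (v i g / s i g - v i h / s i h) ≤ K2 :=
    fun i j g h => hK2 ⟨(i, j, g, h), rfl⟩
  refine ⟨|K1| + |K2| + 1, ?_, ?_⟩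
  · linarith [abs_nonneg K1, abs_nonneg K2]
  intro lam x hlam hx hmax i j henvy
  have hij := henvy.ne hv
  by_contra hcon
  push Not at hcon
  have hlj := hlam j
  obtain ⟨y, hy, hyB, hyv⟩ := henvy
  have hxv : 0 ≤ ∑ g, x i g * v i g := sum_nonneg fun g _ => mul_nonneg (hx.1 i g) (hv i g).le
  rcases lt_or_eq_of_le (hx.2.2 i) with hlt | heq
  · -- budget slack
    obtain ⟨g, hg⟩ : ∃ g, 0 < y g := by
      by_contra hno
      push Not at hno
      have : ∑ g, y g * v i g ≤ 0 :=
        sum_nonpos fun g _ => mul_nonpos_of_nonpos_of_nonneg (hno g) (hv i g).le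
      linarith
    set η := min (y g) ((B i - ∑ g, s i g * x i g) / s i g) with hη
    have hηpos : 0 < η := lt_min hg (div_pos (by linarith) (hs i g))
    have hη2 : s i g * η ≤ B i - ∑ g, s i g * x i g := by
      have := min_le_right (y g) ((B i - ∑ g, s i g * x i g) / s i g)
      rw [← hη, le_div_iff₀ (hs i g)] at this
      linarith
    have h := swap_le hs hx lam hmax hij (Pi.single g η) 0
      (fun k => ?_) (fun k => ⟨le_rfl, hx.1 i k⟩) ?_
    · simp [Pi.single_apply] at h
      have h1 := hK1' i j g
      rw [div_le_iff₀ (hv i g)] at h1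
      have h2 : lam i * v i g ≤ lam j * v j g := by
        have : (lam i * v i g) * η ≤ (lam j * v j g) * η := by linarith
        exact le_of_mul_le_mul_right this hηpos
      have h3 : (|K1| + |K2| + 1) * lam j * v i g ≤ lam i * v i g :=
        mul_le_mul_of_nonneg_right hcon (hv i g).le
      have h4 : v j g < (|K1| + |K2| + 1) * v i g := by
        have : K1 * v i g < (|K1| + |K2| + 1) * v i g :=
          mul_lt_mul_of_pos_right (by linarith [le_abs_self K1, abs_nonneg K2]) (hv i g)
        linarith
      have h5 := mul_lt_mul_of_pos_left h4 hlj
      linarith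
    · by_cases hk : k = g
      · subst hk
        simp only [Pi.single_eq_same]
        exact ⟨hηpos.le, (min_le_left _ _).trans (hy k).2⟩
      · simp [Pi.single_apply, hk, hx.1 j k]
    · simp [Pi.single_apply]
      linarith
  · -- budget tight
    obtain ⟨g, h, hg, hh, hgh⟩ : ∃ g h, 0 < y g ∧ 0 < x i h ∧
        v i h / s i h < v i g / s i g := by
      by_contra hno
      push Not at hno
      have hne : (univ.filter fun g => 0 < y g).Nonempty := by
        by_contra hemp
        rw [not_nonempty_iff_eq_empty, filter_eq_empty_iff] at hemp
        have : ∑ g, y g * v i g ≤ 0 := sum_nonpos fun g _ =>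
          mul_nonpos_of_nonpos_of_nonneg (not_lt.1 (hemp (mem_univ g))) (hv i g).le
        linarith
      obtain ⟨g0, hg0, hmaxg⟩ := exists_max_image _ (fun g => v i g / s i g) hne
      rw [mem_filter] at hg0
      set θ := v i g0 / s i g0 with hθ
      have hθpos : 0 < θ := div_pos (hv i g0) (hs i g0)
      have h1 : ∑ g, y g * v i g ≤ θ * ∑ g, s i g * y g := by
        rw [mul_sum]
        refine sum_le_sum fun g _ => ?_
        rcases lt_or_eq_of_le (hy g).1 with h0 | h0
        · have h2 := hmaxg g (by simp [h0])
          rw [div_le_iff₀ (hs i g)] at h2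
          have := mul_le_mul_of_nonneg_left h2 h0.le
          linarith
        · rw [← h0]; simp
      have h2 : θ * ∑ g, s i g * x i g ≤ ∑ g, x i g * v i g := by
        rw [mul_sum]
        refine sum_le_sum fun g _ => ?_
        rcases lt_or_eq_of_le (hx.1 i g) with h0 | h0
        · have h2 := hno g0 g hg0.2 h0
          rw [← hθ, le_div_iff₀ (hs i g)] at h2
          have := mul_le_mul_of_nonneg_left h2 h0.le
          linarith
        · rw [← h0]; simp
      have h3 := mul_le_mul_of_nonneg_left hyB hθpos.le
      rw [heq] at h2
      linarith
    have hsg := hs i g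
    have hsh := hs i h
    set η := min (y g * s i g) (x i h * s i h) with hη
    have hηpos : 0 < η := lt_min (mul_pos hg hsg) (mul_pos hh hsh)
    have hsw := swap_le hs hx lam hmax hij (Pi.single g (η / s i g)) (Pi.single h (η / s i h))
      (fun k => ?_) (fun k => ?_) ?_
    · simp [Pi.single_apply] at hsw
      have h1 := hK2' i j g h
      rw [div_le_iff₀ (by linarith)] at h1
      have h2 : lam i * (v i g / s i g - v i h / s i h) ≤ lam j * (v j g / s i g) := by
        have : (lam i * (v i g / s i g - v i h / s i h)) * η ≤ (lam j * (v j g / s i g)) * η := by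
          calc _ = lam i * (η / s i g * v i g - η / s i h * v i h) := by ring
            _ ≤ _ := hsw
            _ = _ := by ring
        exact le_of_mul_le_mul_right this hηpos
      have hdpos : 0 < v i g / s i g - v i h / s i h := by linarith
      set dd := v i g / s i g - v i h / s i h
      have h3 : (|K1| + |K2| + 1) * lam j * dd ≤ lam i * dd :=
        mul_le_mul_of_nonneg_right hcon hdpos.le
      have h4 : v j g / s i g < (|K1| + |K2| + 1) * dd := by
        have : K2 * dd < (|K1| + |K2| + 1) * dd :=
          mul_lt_mul_of_pos_right (by linarith [le_abs_self K2, abs_nonneg K1]) hdpos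
        linarith
      have h5 := mul_lt_mul_of_pos_left h4 hlj
      linarith
    · by_cases hk : k = g
      · subst hk
        simp only [Pi.single_eq_same]
        refine ⟨by positivity, le_trans ?_ (hy k).2⟩
        rw [div_le_iff₀ hsg]
        exact min_le_left _ _
      · simp [Pi.single_apply, hk, hx.1 j k]
    · by_cases hk : k = h
      · subst hk
        simp only [Pi.single_eq_same]
        refine ⟨by positivity, ?_⟩
        rw [div_le_iff₀ hsh]
        exact min_le_right _ _
      · simp [Pi.single_apply, hk, hx.1 i k]
    · simp [Pi.single_apply, mul_div_cancel₀, hsg.ne', hsh.ne']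
      have e1 : s i g * (η / s i g) = η := by field_simp
      have e2 : s i h * (η / s i h) = η := by field_simp
      linarith

/-- A continuous measure of envy. -/
lemma exists_envy_fun (v s : Fin n → Fin m → ℝ) (B : Fin n → ℝ)
    (hs : ∀ i g, 0 < s i g) (hB : ∀ i, 0 ≤ B i) :
    ∃ e : (Fin n → Fin m → ℝ) → Fin n → ℝ, Continuous e ∧ (∀ x i, 0 ≤ e x i) ∧
      ∀ x, Feas s B x → ∀ i, 0 < e x i ↔ ∃ j, Envy v s B x i j := by
  let Q : Fin n → Set (Fin m → ℝ) := fun i => Set.Icc 0 1 ∩ {w | ∑ g, s i g * w g ≤ B i}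
  have hQ : ∀ i, IsCompact (Q i) := fun i =>
    isCompact_Icc.inter_right (isClosed_le (by fun_prop) continuous_const)
  have hQne : ∀ i, (Q i).Nonempty := fun i => ⟨0, by simp, by simpa using hB i⟩
  let φ : Fin n → (Fin m → ℝ) → (Fin m → ℝ) → ℝ := fun i y w => ∑ g, min (w g) (y g) * v i g
  have hφ : ∀ i, Continuous (fun z : (Fin m → ℝ) × (Fin m → ℝ) => φ i z.1 z.2) := fun i => by
    simp only [φ]; fun_prop
  let u : Fin n → (Fin m → ℝ) → ℝ := fun i y => sSup (φ i y '' Q i)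
  have hu : ∀ i, Continuous (u i) := fun i => (hQ i).continuous_sSup (hφ i)
  have hbdd : ∀ i y, BddAbove (φ i y '' Q i) := fun i y =>
    ((hQ i).image ((hφ i).comp (Continuous.prodMk_right y))).bddAbove
  refine ⟨fun x i => ∑ j, max 0 (u i (x j) - ∑ g, x i g * v i g), ?_, ?_, ?_⟩
  · refine continuous_pi fun i => continuous_finsetSum _ fun j _ => ?_
    have : Continuous fun x : Fin n → Fin m → ℝ => u i (x j) := (hu i).comp (continuous_apply j)
    fun_prop
  · exact fun x i => sum_nonneg fun j _ => le_max_left _ _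
  · intro x hx i
    constructor
    · intro h
      obtain ⟨j, -, hj⟩ := exists_lt_of_sum_lt (s := univ) (f := fun _ : Fin n => (0 : ℝ))
        (by simpa using h)
      have hj' : ∑ g, x i g * v i g < u i (x j) := by
        rcases lt_max_iff.1 hj with h1 | h1
        · exact absurd h1 (lt_irrefl _)
        · linarith
      obtain ⟨_, ⟨w, hw, rfl⟩, hlt⟩ := exists_lt_of_lt_csSup ((hQne i).image _) hj'
      refine ⟨j, fun g => min (w g) (x j g), fun g => ⟨le_min (hw.1.1 g) (hx.1 j g),
        min_le_right _ _⟩, le_trans (sum_le_sum fun g _ => ?_) hw.2, hlt⟩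
      exact mul_le_mul_of_nonneg_left (min_le_left _ _) (hs i g).le
    · rintro ⟨j, y, hy, hyB, hlt⟩
      refine sum_pos' (fun j _ => le_max_left _ _) ⟨j, mem_univ _, lt_max_of_lt_right ?_⟩
      have h1 : φ i (x j) y ≤ u i (x j) := le_csSup (hbdd i _) ⟨y, ⟨⟨fun g => (hy g).1,
        fun g => (hy g).2.trans (hx.le_one j g)⟩, hyB⟩, rfl⟩
      have h2 : φ i (x j) y = ∑ g, y g * v i g :=
        sum_congr rfl fun g _ => by rw [min_eq_left (hy g).2]
      linarith

/-- The fixed point step. -/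
lemma exists_equilibrium (v s : Fin n → Fin m → ℝ) (B : Fin n → ℝ) (hB : ∀ i, 0 ≤ B i)
    (e : (Fin n → Fin m → ℝ) → Fin n → ℝ) (he : Continuous e) (he0 : ∀ x i, 0 ≤ e x i)
    (δ : ℝ) :
    ∃ (μ : Fin n → ℝ) (x : Fin n → Fin m → ℝ), (∀ i, 0 ≤ μ i) ∧ Feas s B x ∧
      (∀ x', Feas s B x' → ∑ i, (δ + μ i) * ∑ g, x' i g * v i g
        ≤ ∑ i, (δ + μ i) * ∑ g, x i g * v i g) ∧
      ∀ i, e x i = μ i * ∑ k, e x k := by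
  classical
  let ι := Fin n ⊕ (Fin n × Fin m)
  let X : EuclideanSpace ℝ ι → Fin n → Fin m → ℝ := fun z i g => z (Sum.inr (i, g))
  have hX : Continuous X := by
    simp only [X]; fun_prop
  let K0 : Set (ι → ℝ) := Set.Icc 0 1 ∩ {z | (∀ g, ∑ i, z (Sum.inr (i, g)) ≤ 1) ∧
    ∀ i, ∑ g, s i g * z (Sum.inr (i, g)) ≤ B i}
  have hK0c : IsCompact K0 := by
    refine isCompact_Icc.inter_right ?_
    rw [Set.ofPred_and, Set.ofPred_forall, Set.ofPred_forall]
    exact (isClosed_iInter fun g => isClosed_le (by fun_prop) continuous_const).inter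
      (isClosed_iInter fun g => isClosed_le (by fun_prop) continuous_const)
  let K : Set (EuclideanSpace ℝ ι) := (EuclideanSpace.equiv ι ℝ) ⁻¹' K0
  have hKc : IsCompact K :=
    (EuclideanSpace.equiv ι ℝ).toHomeomorph.isCompact_preimage.2 hK0c
  have hK0conv : Convex ℝ K0 := by
    refine (convex_Icc 0 1).inter ?_
    intro z hz w hw a b ha hb hab
    refine ⟨fun g => ?_, fun i => ?_⟩
    · have h1 := mul_le_mul_of_nonneg_left (hz.1 g) ha
      have h2 := mul_le_mul_of_nonneg_left (hw.1 g) hb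
      simp only [Pi.add_apply, Pi.smul_apply, smul_eq_mul, sum_add_distrib, ← mul_sum]
      linarith
    · have h1 := mul_le_mul_of_nonneg_left (hz.2 i) ha
      have h2 := mul_le_mul_of_nonneg_left (hw.2 i) hb
      simp only [Pi.add_apply, Pi.smul_apply, smul_eq_mul, mul_add, sum_add_distrib,
        mul_left_comm (s _ _), ← mul_sum]
      have : a * B i + b * B i = B i := by rw [← add_mul, hab, one_mul]
      linarith
  have hKconv : Convex ℝ K := hK0conv.linear_preimage (EuclideanSpace.equiv ι ℝ).toLinearMap
  have hmem : ∀ (a : Fin n → ℝ) (y : Fin n → Fin m → ℝ), (∀ i, 0 ≤ a i ∧ a i ≤ 1) → Feas s B y →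
      WithLp.toLp 2 (Sum.elim a (fun p => y p.1 p.2)) ∈ K := by
    intro a y ha hy
    refine ⟨⟨?_, ?_⟩, ?_, ?_⟩
    · rintro (i | ⟨i, g⟩)
      · exact (ha i).1
      · exact hy.1 i g
    · rintro (i | ⟨i, g⟩)
      · exact (ha i).2
      · exact hy.le_one i g
    · exact hy.2.1
    · exact hy.2.2
  have hKne : K.Nonempty := ⟨_, hmem 0 0 (fun i => by simp) ⟨by simp, by simp, by simpa using hB⟩⟩
  let F : EuclideanSpace ℝ ι → EuclideanSpace ℝ ι := fun z => WithLp.toLp 2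
    (Sum.elim (fun i => e (X z) i - z (Sum.inl i) * ∑ k, e (X z) k)
      (fun p => (δ + z (Sum.inl p.1)) * v p.1 p.2))
  have hF : Continuous F := by
    refine (PiLp.continuous_toLp 2 _).comp (continuous_pi ?_)
    have h1 : ∀ i, Continuous fun z => e (X z) i := fun i =>
      (continuous_apply i).comp (he.comp hX)
    rintro (i | p)
    · simp only [Sum.elim_inl]
      fun_prop
    · simp only [Sum.elim_inr]
      fun_prop
  obtain ⟨z, hzK, hz⟩ := exists_vi hKne hKc hKconv F hF
  have hzx : Feas s B (X z) := ⟨fun i g => hzK.1.1 (Sum.inr (i, g)), hzK.2.1, hzK.2.2⟩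
  set μ : Fin n → ℝ := fun i => z (Sum.inl i) with hμ
  have hμ01 : ∀ i, 0 ≤ μ i ∧ μ i ≤ 1 := fun i =>
    ⟨hzK.1.1 (Sum.inl i), hzK.1.2 (Sum.inl i)⟩
  have hvi : ∀ (a : Fin n → ℝ) (y : Fin n → Fin m → ℝ), (∀ i, 0 ≤ a i ∧ a i ≤ 1) →
      Feas s B y → ∑ i, (a i - μ i) * (e (X z) i - μ i * ∑ k, e (X z) k)
        + ∑ i, ∑ g, (y i g - X z i g) * ((δ + μ i) * v i g) ≤ 0 := by
    intro a y ha hy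
    have h := hz _ (hmem a y ha hy)
    rw [PiLp.inner_apply, Fintype.sum_sum_type, Fintype.sum_prod_type] at h
    simpa [F, X, hμ] using h
  refine ⟨μ, X z, fun i => (hμ01 i).1, hzx, ?_, ?_⟩
  · intro x' hx'
    have h := hvi μ x' hμ01 hx'
    simp only [sub_self, zero_mul, sum_const_zero, zero_add] at h
    rw [← sub_nonpos, ← sum_sub_distrib]
    refine le_trans (le_of_eq (sum_congr rfl fun i _ => ?_)) h
    rw [← mul_sub, ← sum_sub_distrib, mul_sum]
    exact sum_congr rfl fun g _ => by ring
  · intro i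
    set T := ∑ k, e (X z) k with hT
    have hle : e (X z) i ≤ T := single_le_sum (fun k _ => he0 (X z) k) (mem_univ i)
    have hone : ∀ c, 0 ≤ c → c ≤ 1 → (c - μ i) * (e (X z) i - μ i * T) ≤ 0 := by
      intro c hc0 hc1
      have h := hvi (Function.update μ i c) (X z) (fun k => ?_) hzx
      · simp only [sub_self, zero_mul, sum_const_zero, add_zero] at h
        rw [sum_eq_single i] at h
        · simpa using h
        · intro k _ hk
          simp [hk]
        · simp
      · by_cases hk : k = i
        · subst hk; simp [hc0, hc1]
        · simpa [hk] using hμ01 k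
    have h0 := hone 0 le_rfl zero_le_one
    have h1 := hone 1 zero_le_one le_rfl
    have hei := he0 (X z) i
    obtain ⟨hm0, hm1⟩ := hμ01 i
    by_contra hne
    rcases lt_or_gt_of_ne hne with hlt | hgt
    · have : μ i ≤ 0 := by
        by_contra hh
        push Not at hh
        nlinarith
      have : μ i = 0 := le_antisymm this hm0
      rw [this] at hlt
      linarith
    · have : 1 ≤ μ i := by
        by_contra hh
        push Not at hh
        nlinarith
      have : μ i = 1 := le_antisymm hm1 this
      rw [this] at hgt
      linarith

/-- The core existence statement. -/
lemma core_exists (v s : Fin n → Fin m → ℝ) (B : Fin n → ℝ)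
    (hv : ∀ i g, 0 < v i g) (hs : ∀ i g, 0 < s i g) (hB : ∀ i, 0 ≤ B i) :
    ∃ (lam : Fin n → ℝ) (x : Fin n → Fin m → ℝ), (∀ i, 0 < lam i) ∧ Feas s B x ∧
      (∀ x', Feas s B x' → ∑ i, lam i * ∑ g, x' i g * v i g
        ≤ ∑ i, lam i * ∑ g, x i g * v i g) ∧
      ∀ i j, ¬ Envy v s B x i j := by
  classical
  obtain ⟨K, hK1, hK⟩ := exists_ratio (B := B) hv hs
  have hKpos : 0 < K := by linarith
  obtain ⟨e, hec, he0, he⟩ := exists_envy_fun v s B hs hB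
  set δ : ℝ := 1 / (2 * (n + 1) * K ^ n) with hδ
  have hδpos : 0 < δ := by positivity
  obtain ⟨μ, x, hμ, hx, hmax, hfix⟩ := exists_equilibrium v s B hB e hec he0 δ
  have hlam : ∀ i, 0 < δ + μ i := fun i => by linarith [hμ i]
  refine ⟨fun i => δ + μ i, x, hlam, hx, hmax, ?_⟩
  by_contra hcon
  push Not at hcon
  obtain ⟨i1, j1, h1⟩ := hcon
  set T := ∑ k, e x k with hT
  have hTpos : 0 < T :=
    sum_pos' (fun k _ => he0 x k) ⟨i1, mem_univ _, (he x hx i1).2 ⟨j1, h1⟩⟩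
  have hμsum : ∑ i, μ i = 1 := by
    have h2 : T = (∑ i, μ i) * T := by
      rw [sum_mul]; exact sum_congr rfl fun i _ => hfix i
    have h3 : (∑ i, μ i - 1) * T = 0 := by linarith
    rcases mul_eq_zero.1 h3 with h4 | h4
    · linarith
    · exact absurd h4 hTpos.ne'
  obtain ⟨i0, hi0⟩ : ∃ i0, 1 / ((n : ℝ) + 1) ≤ μ i0 := by
    by_contra hno
    push Not at hno
    have h2 : ∑ i, μ i ≤ ∑ _i : Fin n, 1 / ((n : ℝ) + 1) := sum_le_sum fun i _ => (hno i).le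
    rw [hμsum] at h2
    simp only [sum_const, card_univ, Fintype.card_fin, nsmul_eq_mul] at h2
    rw [mul_one_div, le_div_iff₀ (by positivity)] at h2
    linarith
  have hex : ∀ i, ∃ j, 0 < μ i → Envy v s B x i j := by
    intro i
    by_cases hi : 0 < μ i
    · obtain ⟨j, hj⟩ := (he x hx i).1 (by rw [hfix i]; positivity)
      exact ⟨j, fun _ => hj⟩
    · exact ⟨i, fun h => absurd h hi⟩
  choose f hf using hex
  have hpos : ∀ k ≤ n, ∀ i, 1 / ((n : ℝ) + 1) ≤ K ^ k * (δ + μ i) → 0 < μ i := by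
    intro k hk i h2
    by_contra hno
    have h3 : μ i = 0 := le_antisymm (not_lt.1 hno) (hμ i)
    rw [h3, add_zero] at h2
    have h4 : K ^ k * δ ≤ K ^ n * δ :=
      mul_le_mul_of_nonneg_right (pow_le_pow_right₀ hK1 hk) hδpos.le
    have h5 : K ^ n * δ = 1 / ((n : ℝ) + 1) / 2 := by
      rw [hδ]; field_simp
    have h6 : 0 < 1 / ((n : ℝ) + 1) := by positivity
    linarith
  have hiter : ∀ k ≤ n, 1 / ((n : ℝ) + 1) ≤ K ^ k * (δ + μ (f^[k] i0)) := by
    intro k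
    induction k with
    | zero => intro _; simp only [pow_zero, one_mul, Function.iterate_zero, id]; linarith
    | succ k ih =>
      intro hk
      have h2 := ih (by omega)
      have h3 := hf _ (hpos k (by omega) _ h2)
      have h4 := hK (fun i => δ + μ i) x hlam hx hmax _ _ h3
      rw [Function.iterate_succ_apply', pow_succ, mul_assoc]
      exact h2.trans (mul_le_mul_of_nonneg_left h4.le (by positivity))
  have henvy : ∀ k ≤ n, Envy v s B x (f^[k] i0) (f (f^[k] i0)) := fun k hk =>
    hf _ (hpos k hk _ (hiter k hk))
  obtain ⟨a, ha, b, hb, hab, hfab⟩ := exists_ne_map_eq_of_card_lt_of_maps_to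
    (s := range (n + 1)) (t := (univ : Finset (Fin n))) (f := fun k => f^[k] i0)
    (by simp) (fun _ _ => mem_univ _)
  wlog hlt : a < b generalizing a b
  · exact this b hb a ha hab.symm hfab.symm (by omega)
  rw [mem_range] at ha hb
  obtain ⟨x', hx', hge, i, hgt⟩ := cycle_improve (v := v) hx f (f^[a] i0) (b - a) (by omega)
    (by rw [← Function.iterate_add_apply, Nat.sub_add_cancel hlt.le]; exact hfab.symm)
    (fun k hk => by
      rw [← Function.iterate_add_apply]
      exact henvy _ (by omega))
  have h2 := hmax x' hx'
  have h3 : ∑ i, (δ + μ i) * ∑ g, x i g * v i g < ∑ i, (δ + μ i) * ∑ g, x' i g * v i g :=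
    sum_lt_sum (fun i _ => mul_le_mul_of_nonneg_left (hge i) (hlam i).le)
      ⟨i, mem_univ _, mul_lt_mul_of_pos_left hgt (hlam i)⟩
  linarith

end AllocPart


/-- Under generalized assignment constraints with all values and sizes
positive and nonnegative budgets, there always exists a feasible allocation that is both
FEF (no agent feasibly envies any other agent or the charity) and Pareto-optimal among all
feasible allocations. -/
theorem fef_and_pareto_optimal_exists (n m : ℕ)
    (v s : Fin n → Fin m → ℝ) (B : Fin n → ℝ)
    (hv : ∀ i g, 0 < v i g) (hs : ∀ i g, 0 < s i g) (hB : ∀ i, 0 ≤ B i) :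
    ∃ x : Fin n → Fin m → ℝ,
      (∀ i g, 0 ≤ x i g ∧ x i g ≤ 1) ∧
      (∀ g, ∑ i, x i g ≤ 1) ∧
      (∀ i, ∑ g, s i g * x i g ≤ B i) ∧
      -- FEF towards other agents:
      (∀ i j, i ≠ j → ∀ y : Fin m → ℝ,
        (∀ g, 0 ≤ y g ∧ y g ≤ x j g) → (∑ g, s i g * y g ≤ B i) →
        ∑ g, y g * v i g ≤ ∑ g, x i g * v i g) ∧
      -- FEF towards the charity:
      (∀ i, ∀ y : Fin m → ℝ,
        (∀ g, 0 ≤ y g ∧ y g ≤ 1 - ∑ k, x k g) → (∑ g, s i g * y g ≤ B i) →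
        ∑ g, y g * v i g ≤ ∑ g, x i g * v i g) ∧
      -- Pareto-optimality among all feasible allocations:
      (¬ ∃ x' : Fin n → Fin m → ℝ,
        (∀ i g, 0 ≤ x' i g ∧ x' i g ≤ 1) ∧ (∀ g, ∑ i, x' i g ≤ 1) ∧
        (∀ i, ∑ g, s i g * x' i g ≤ B i) ∧
        (∀ i, ∑ g, x i g * v i g ≤ ∑ g, x' i g * v i g) ∧
        (∃ i, ∑ g, x i g * v i g < ∑ g, x' i g * v i g)) := by
  obtain ⟨lam, x, hlam, hx, hmax, hnoenvy⟩ := core_exists v s B hv hs hB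
  have hPO : ¬ ∃ x', Feas s B x' ∧ (∀ i, ∑ g, x i g * v i g ≤ ∑ g, x' i g * v i g) ∧
      ∃ i, ∑ g, x i g * v i g < ∑ g, x' i g * v i g := by
    rintro ⟨x', hx', hge, i, hgt⟩
    have h2 := hmax x' hx'
    have h3 : ∑ i, lam i * ∑ g, x i g * v i g < ∑ i, lam i * ∑ g, x' i g * v i g :=
      sum_lt_sum (fun i _ => mul_le_mul_of_nonneg_left (hge i) (hlam i).le)
        ⟨i, mem_univ _, mul_lt_mul_of_pos_left hgt (hlam i)⟩
    linarith
  refine ⟨x, fun i g => ⟨hx.1 i g, hx.le_one i g⟩, hx.2.1, hx.2.2, ?_, ?_, ?_⟩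
  · intro i j _ y hy hyB
    by_contra hlt
    exact hnoenvy i j ⟨y, hy, hyB, not_le.1 hlt⟩
  · intro i y hy hyB
    by_contra hlt
    push Not at hlt
    refine hPO ⟨Function.update x i y, ⟨?_, ?_, ?_⟩, ?_, i, by simpa using hlt⟩
    · intro k g
      by_cases hk : k = i
      · subst hk; simpa using (hy g).1
      · simpa [hk] using hx.1 k g
    · intro g
      have h1 : ∑ k, Function.update x i y k g ≤ ∑ k, (x k g + if k = i then y g else 0) := by
        refine sum_le_sum fun k _ => ?_
        by_cases hk : k = i
        · subst hk; simpa using hx.1 k g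
        · simp [hk]
      simp only [sum_add_distrib, sum_ite_eq', mem_univ, if_true] at h1
      linarith [(hy g).2]
    · intro k
      by_cases hk : k = i
      · subst hk; simpa using hyB
      · simpa [hk] using hx.2.2 k
    · intro k
      by_cases hk : k = i
      · subst hk; simpa using hlt.le
      · simp [hk]
  · rintro ⟨x', h1, h2, h3, h4, h5⟩
    exact hPO ⟨x', ⟨fun i g => (h1 i g).1, h2, h3⟩, h4, h5⟩
end

section
/- In the unconstrained instance with 2 agents and 2 goods where agent 1 has values (α, 1−α), agent 2 has values (β, 1−β), and 1/2 < β < α < 1, every allocation x that is both envy-free and Pareto-optimal satisfies x_{1,2} = 0 and 1/(2α) ≤ x_{1,1} ≤ 1/(2β). -/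
open Finset

/-- The valuation profile of the counterexample instance: agent 1 (index 0) has values
`(a, 1 - a)` and agent 2 (index 1) has values `(b, 1 - b)`. -/
def cxVal (a b : ℝ) : Fin 2 → Fin 2 → ℝ := ![![a, 1 - a], ![b, 1 - b]]

/-- in the unconstrained instance with 2 agents and 2 goods with values
`(α, 1-α)` and `(β, 1-β)` where `1/2 < β < α < 1`, every envy-free and Pareto-optimal
allocation `x` satisfies `x 0 1 = 0` and `1/(2α) ≤ x 0 0 ≤ 1/(2β)`. -/
theorem ef_po_structure (α β : ℝ)
    (hβ : 1 / 2 < β) (hβα : β < α) (hα : α < 1)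
    (x : Fin 2 → Fin 2 → ℝ)
    (hxbox : ∀ i g, 0 ≤ x i g ∧ x i g ≤ 1)
    (hxsum : ∀ g, ∑ i, x i g ≤ 1)
    -- envy-freeness towards the other agent and towards the charity
    (hEF : ∀ i j : Fin 2, ∑ g, x j g * cxVal α β i g ≤ ∑ g, x i g * cxVal α β i g)
    (hEFc : ∀ i : Fin 2, ∑ g, (1 - ∑ k, x k g) * cxVal α β i g ≤ ∑ g, x i g * cxVal α β i g)
    -- Pareto-optimality
    (hPO : ¬ ∃ x' : Fin 2 → Fin 2 → ℝ,
      (∀ i g, 0 ≤ x' i g ∧ x' i g ≤ 1) ∧ (∀ g, ∑ i, x' i g ≤ 1) ∧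
      (∀ i, ∑ g, x i g * cxVal α β i g ≤ ∑ g, x' i g * cxVal α β i g) ∧
      (∃ i, ∑ g, x i g * cxVal α β i g < ∑ g, x' i g * cxVal α β i g)) :
    x 0 1 = 0 ∧ 1 / (2 * α) ≤ x 0 0 ∧ x 0 0 ≤ 1 / (2 * β) := by
  simp only [Fin.sum_univ_two, Fin.forall_fin_two, Fin.exists_fin_two, cxVal, Matrix.cons_val_zero,
    Matrix.cons_val_one] at hxbox hxsum hEF hEFc hPO
  obtain ⟨⟨⟨ha0, ha1⟩, hb0, hb1⟩, ⟨hc0, hc1⟩, hd0, hd1⟩ := hxbox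
  obtain ⟨hs0, hs1⟩ := hxsum
  obtain ⟨⟨-, hE1⟩, hE2, -⟩ := hEF
  have key : ∀ a b c d : ℝ, 0 ≤ a → 0 ≤ b → 0 ≤ c → 0 ≤ d → a + c ≤ 1 → b + d ≤ 1 →
      x 0 0 * α + x 0 1 * (1 - α) < a * α + b * (1 - α) →
      x 1 0 * β + x 1 1 * (1 - β) ≤ c * β + d * (1 - β) → False := by
    intro a b c d h1 h2 h3 h4 h5 h6 h7 h8
    apply hPO
    refine ⟨![![a, b], ![c, d]], ?_⟩
    simp only [Matrix.cons_val_zero, Matrix.cons_val_one]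
    exact ⟨⟨⟨⟨h1, by linarith⟩, h2, by linarith⟩, ⟨h3, by linarith⟩, h4, by linarith⟩,
      ⟨h5, h6⟩, ⟨h7.le, h8⟩, Or.inl h7⟩
  have hac : x 0 0 + x 1 0 = 1 := by
    by_contra h
    have hlt := lt_of_le_of_ne hs0 h
    refine key (1 - x 1 0) (x 0 1) (x 1 0) (x 1 1) (by linarith) hb0 hc0 hd0 (by linarith) hs1
      ?_ le_rfl
    nlinarith
  have hbd : x 0 1 + x 1 1 = 1 := by
    by_contra h
    have hlt := lt_of_le_of_ne hs1 h
    refine key (x 0 0) (1 - x 1 1) (x 1 0) (x 1 1) ha0 (by linarith) hc0 hd0 hs0 (by linarith)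
      ?_ le_rfl
    nlinarith
  have hb : x 0 1 = 0 := by
    by_contra h
    have hbpos : 0 < x 0 1 := lt_of_le_of_ne hb0 (Ne.symm h)
    rcases hc0.eq_or_lt with hc | hc
    · have ha : x 0 0 = 1 := by linarith
      rw [← hc, ha] at hE2
      nlinarith
    · obtain ⟨t, ht, htb, htc⟩ : ∃ t : ℝ, 0 < t ∧ t ≤ x 0 1 ∧ t ≤ x 1 0 :=
        ⟨min (x 0 1) (x 1 0), lt_min hbpos hc, min_le_left _ _, min_le_right _ _⟩
      have e1 : t * β ≤ t := by nlinarith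
      have e2 : 0 ≤ t * β := by nlinarith
      have e3 : 0 < t * (α - β) := mul_pos ht (by linarith)
      refine key (x 0 0 + t * (1 - β)) (x 0 1 - t * β) (x 1 0 - t * (1 - β)) (x 1 1 + t * β)
        ?_ ?_ ?_ ?_ ?_ ?_ ?_ ?_ <;> nlinarith
  have hd : x 1 1 = 1 := by linarith
  have hc : x 1 0 = 1 - x 0 0 := by linarith
  rw [hb, hd, hc] at hE1 hE2
  refine ⟨hb, ?_, ?_⟩
  · rw [div_le_iff₀ (by linarith)]
    linarith
  · rw [le_div_iff₀ (by linarith)]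
    linarith
end

section
/- Truthfulness is compatible with FEF for two agents: for every number of goods m, sizes s_{i,g} > 0, and budgets B_i ≥ 0 under generalized assignment constraints, there exists a mechanism M mapping each pair of additive valuation vectors (v_1, v_2) with nonnegative values to a feasible allocation such that (i) M is truthful, i.e., no agent can strictly increase her value with respect to her true valuation by misreporting, and (ii) for every reported profile, the allocation M(v_1, v_2) is FEF. -/
open Finset

lemma exists_best_half (m : ℕ) (s : Fin m → ℝ) (B : ℝ) (hB : 0 ≤ B) (v : Fin m → ℝ) :
    ∃ x : Fin m → ℝ, (∀ g, 0 ≤ x g ∧ x g ≤ 1 / 2) ∧ (∑ g, s g * x g ≤ B) ∧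
      ∀ y : Fin m → ℝ, (∀ g, 0 ≤ y g ∧ y g ≤ 1 / 2) → (∑ g, s g * y g ≤ B) →
        ∑ g, y g * v g ≤ ∑ g, x g * v g := by
  have hK : IsCompact (Set.Icc (fun _ : Fin m => (0 : ℝ)) (fun _ => 1 / 2) ∩
      {x | ∑ g, s g * x g ≤ B}) :=
    isCompact_Icc.inter_right (isClosed_le (by fun_prop) (by fun_prop))
  obtain ⟨x, hx, hmax⟩ := hK.exists_isMaxOn (f := fun y => ∑ g, y g * v g)
    ⟨fun _ => 0, ⟨⟨fun _ => le_refl _, fun _ => by norm_num⟩, by simpa using hB⟩⟩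
    (by fun_prop)
  refine ⟨x, fun g => ⟨hx.1.1 g, hx.1.2 g⟩, hx.2, fun y hy hyB => ?_⟩
  exact hmax ⟨⟨fun g => (hy g).1, fun g => (hy g).2⟩, hyB⟩

/-- Truthfulness is compatible with FEF for two agents: under generalized
assignment constraints (positive sizes, nonnegative budgets), there exists a mechanism `M`
mapping each pair of nonnegative additive valuation vectors to a feasible allocation which
is truthful and always outputs an FEF allocation. -/
theorem truthful_fef_mechanism_two_agents (m : ℕ)
    (s : Fin 2 → Fin m → ℝ) (B : Fin 2 → ℝ)
    (hs : ∀ i g, 0 < s i g) (hB : ∀ i, 0 ≤ B i) :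
    ∃ M : (Fin 2 → Fin m → ℝ) → (Fin 2 → Fin m → ℝ),
      -- (ii) on every nonnegative reported profile, M outputs a feasible FEF allocation
      (∀ v : Fin 2 → Fin m → ℝ, (∀ i g, 0 ≤ v i g) →
        (∀ i g, 0 ≤ M v i g ∧ M v i g ≤ 1) ∧
        (∀ g, ∑ i, M v i g ≤ 1) ∧
        (∀ i, ∑ g, s i g * M v i g ≤ B i) ∧
        -- no feasible envy towards the other agent
        (∀ i j : Fin 2, i ≠ j → ∀ y : Fin m → ℝ,
          (∀ g, 0 ≤ y g ∧ y g ≤ M v j g) → (∑ g, s i g * y g ≤ B i) →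
          ∑ g, y g * v i g ≤ ∑ g, M v i g * v i g) ∧
        -- no feasible envy towards the charity
        (∀ i : Fin 2, ∀ y : Fin m → ℝ,
          (∀ g, 0 ≤ y g ∧ y g ≤ 1 - ∑ k, M v k g) → (∑ g, s i g * y g ≤ B i) →
          ∑ g, y g * v i g ≤ ∑ g, M v i g * v i g)) ∧
      -- (i) truthfulness: no agent can strictly gain (w.r.t. her true valuation `v i`)
      -- by misreporting, the other agent's report being fixed
      (∀ v : Fin 2 → Fin m → ℝ, (∀ i g, 0 ≤ v i g) →
        ∀ (i : Fin 2) (v' : Fin m → ℝ), (∀ g, 0 ≤ v' g) →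
        ∑ g, M (Function.update v i v') i g * v i g ≤ ∑ g, M v i g * v i g) := by
  choose F hF hFB hmax using fun i v => exists_best_half m (s i) (B i) (hB i) v
  refine ⟨fun v i => F i (v i), fun v hv => ⟨fun i g => ?_, fun g => ?_, fun i => hFB i _, ?_, ?_⟩,
    fun v hv i v' hv' => ?_⟩
  · have := hF i (v i) g
    exact ⟨this.1, by linarith⟩
  · have h0 := hF 0 (v 0) g
    have h1 := hF 1 (v 1) g
    simp only [Fin.sum_univ_two]
    linarith
  · intro i j _ y hy hyB
    exact hmax i (v i) y (fun g => ⟨(hy g).1, (hy g).2.trans (hF j (v j) g).2⟩) hyB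
  · intro i y hy hyB
    have hle : ∀ g, F i (v i) g ≤ ∑ k, F k (v k) g := fun g =>
      Finset.single_le_sum (f := fun k => F k (v k) g) (fun k _ => (hF k (v k) g).1)
        (Finset.mem_univ i)
    have h := hmax i (v i) (fun g => 1 / 2 * F i (v i) g + 1 / 2 * y g)
      (fun g => by
        have h1 := hF i (v i) g
        have h2 := hy g
        have h3 := hle g
        constructor <;> linarith)
      (by
        have h1 := hFB i (v i)
        have : ∑ g, s i g * (1 / 2 * F i (v i) g + 1 / 2 * y g) =
            1 / 2 * ∑ g, s i g * F i (v i) g + 1 / 2 * ∑ g, s i g * y g := by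
          rw [Finset.mul_sum, Finset.mul_sum, ← Finset.sum_add_distrib]
          exact Finset.sum_congr rfl fun g _ => by ring
        linarith)
    have : ∑ g, (1 / 2 * F i (v i) g + 1 / 2 * y g) * v i g =
        1 / 2 * ∑ g, F i (v i) g * v i g + 1 / 2 * ∑ g, y g * v i g := by
      rw [Finset.mul_sum, Finset.mul_sum, ← Finset.sum_add_distrib]
      exact Finset.sum_congr rfl fun g _ => by ring
    linarith
  · simp only [Function.update_self]
    exact hmax i (v i) _ (hF i v') (hFB i v')
end

section
/- Truthfulness is compatible with Pareto-optimality: for every number of agents n, number of goods m, sizes s_{i,g} ≥ 0, and budgets B_i ≥ 0 under generalized assignment constraints, there exists a mechanism M mapping each profile of additive valuation vectors (v_1, …, v_n) with nonnegative values to a feasible allocation such that (i) M is truthful, i.e., no agent can strictly increase her value with respect to her true valuation by misreporting, and (ii) for every reported profile, the allocation M(v_1, …, v_n) is Pareto-optimal among all feasible allocations. -/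
open Finset

/-- Lexicographic optimizers (serial dictatorship) within the set `F`. -/
def lexOpt {X : Type} (F : Set X) (u : ℕ → X → ℝ) : ℕ → Set X
  | 0 => F
  | k + 1 => {x | x ∈ lexOpt F u k ∧ ∀ y ∈ lexOpt F u k, u k y ≤ u k x}

theorem lexOpt_congr {X : Type} (F : Set X) (u w : ℕ → X → ℝ) (k : ℕ)
    (h : ∀ j < k, u j = w j) : lexOpt F u k = lexOpt F w k := by
  induction k with
  | zero => rfl
  | succ k ih =>
    have h1 := ih (fun j hj => h j (by omega))
    simp only [lexOpt, h1, h k (by omega)]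

theorem lexOpt_anti {X : Type} (F : Set X) (u : ℕ → X → ℝ) {j k : ℕ} (h : j ≤ k) :
    lexOpt F u k ⊆ lexOpt F u j := by
  induction h with
  | refl => exact subset_rfl
  | step _ ih => exact fun x hx => ih hx.1

theorem lexOpt_compact {X : Type} [TopologicalSpace X] (F : Set X) (u : ℕ → X → ℝ)
    (hF : IsCompact F) (hne : F.Nonempty) (hu : ∀ k, Continuous (u k)) (k : ℕ) :
    IsCompact (lexOpt F u k) ∧ (lexOpt F u k).Nonempty := by
  induction k with
  | zero => exact ⟨hF, hne⟩
  | succ k ih =>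
    obtain ⟨hc, hn⟩ := ih
    constructor
    · have hcl : IsClosed {x | ∀ y ∈ lexOpt F u k, u k y ≤ u k x} := by
        simp only [Set.setOf_forall]
        exact isClosed_iInter fun y => isClosed_iInter fun _ =>
          isClosed_le continuous_const (hu k)
      exact hc.inter_right hcl
    · obtain ⟨x, hx, hmax⟩ := hc.exists_isMaxOn hn (hu k).continuousOn
      exact ⟨x, hx, fun y hy => hmax hy⟩

theorem lexOpt_pareto {X : Type} (F : Set X) (u : ℕ → X → ℝ) (k : ℕ) (x y : X)
    (hx : x ∈ lexOpt F u k) (hy : y ∈ F) (h : ∀ j < k, u j x ≤ u j y) :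
    y ∈ lexOpt F u k ∧ ∀ j < k, u j y ≤ u j x := by
  induction k with
  | zero => exact ⟨hy, fun j hj => absurd hj (by omega)⟩
  | succ k ih =>
    obtain ⟨h1, h2⟩ := ih hx.1 (fun j hj => h j (by omega))
    refine ⟨⟨h1, fun z hz => (hx.2 z hz).trans (h k (by omega))⟩, fun j hj => ?_⟩
    rcases Nat.lt_succ_iff_lt_or_eq.mp hj with hj | rfl
    · exact h2 j hj
    · exact hx.2 y h1

/-- Value of agent `k` under allocation `x` (zero when there is no such agent). -/
def agentVal {n m : ℕ} (v : Fin n → Fin m → ℝ) (k : ℕ) (x : Fin n → Fin m → ℝ) : ℝ :=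
  if h : k < n then ∑ g, x ⟨k, h⟩ g * v ⟨k, h⟩ g else 0

theorem agentVal_fin {n m : ℕ} (v : Fin n → Fin m → ℝ) (i : Fin n) (x : Fin n → Fin m → ℝ) :
    agentVal v i x = ∑ g, x i g * v i g := by
  simp [agentVal]

theorem agentVal_continuous {n m : ℕ} (v : Fin n → Fin m → ℝ) (k : ℕ) :
    Continuous (agentVal v k) := by
  unfold agentVal
  split_ifs <;> fun_prop

/-- The feasible allocations. -/
def feas {n m : ℕ} (s : Fin n → Fin m → ℝ) (B : Fin n → ℝ) : Set (Fin n → Fin m → ℝ) :=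
  {x | (∀ i g, 0 ≤ x i g ∧ x i g ≤ 1) ∧ (∀ g, ∑ i, x i g ≤ 1) ∧ ∀ i, ∑ g, s i g * x i g ≤ B i}

theorem feas_compact {n m : ℕ} (s : Fin n → Fin m → ℝ) (B : Fin n → ℝ) :
    IsCompact (feas s B) := by
  have h1 : IsCompact (Set.Icc (0 : Fin n → Fin m → ℝ) 1) := isCompact_Icc
  refine h1.of_isClosed_subset ?_ ?_
  · simp only [feas, Set.setOf_and, Set.setOf_forall]
    refine IsClosed.inter ?_ (IsClosed.inter ?_ ?_)
    · exact isClosed_iInter fun i => isClosed_iInter fun g =>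
        (isClosed_le (by fun_prop) (by fun_prop)).inter (isClosed_le (by fun_prop) (by fun_prop))
    · exact isClosed_iInter fun g => isClosed_le (by fun_prop) (by fun_prop)
    · exact isClosed_iInter fun i => isClosed_le (by fun_prop) (by fun_prop)
  · intro x hx
    exact ⟨fun i g => (hx.1 i g).1, fun i g => (hx.1 i g).2⟩

/-- Truthfulness is compatible with Pareto-optimality: under generalized
assignment constraints (nonnegative sizes and budgets), there exists a mechanism `M`
mapping each profile of nonnegative additive valuation vectors to a feasible allocation
which is truthful and always outputs a Pareto-optimal allocation. -/
theorem truthful_po_mechanism (n m : ℕ)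
    (s : Fin n → Fin m → ℝ) (B : Fin n → ℝ)
    (hs : ∀ i g, 0 ≤ s i g) (hB : ∀ i, 0 ≤ B i) :
    ∃ M : (Fin n → Fin m → ℝ) → (Fin n → Fin m → ℝ),
      -- (ii) on every nonnegative reported profile, M outputs a feasible Pareto-optimal
      -- allocation
      (∀ v : Fin n → Fin m → ℝ, (∀ i g, 0 ≤ v i g) →
        (∀ i g, 0 ≤ M v i g ∧ M v i g ≤ 1) ∧
        (∀ g, ∑ i, M v i g ≤ 1) ∧
        (∀ i, ∑ g, s i g * M v i g ≤ B i) ∧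
        (¬ ∃ x' : Fin n → Fin m → ℝ,
          (∀ i g, 0 ≤ x' i g ∧ x' i g ≤ 1) ∧ (∀ g, ∑ i, x' i g ≤ 1) ∧
          (∀ i, ∑ g, s i g * x' i g ≤ B i) ∧
          (∀ i, ∑ g, M v i g * v i g ≤ ∑ g, x' i g * v i g) ∧
          (∃ i, ∑ g, M v i g * v i g < ∑ g, x' i g * v i g))) ∧
      -- (i) truthfulness: no agent can strictly gain (w.r.t. her true valuation `v i`)
      -- by misreporting, the other agents' reports being fixed
      (∀ v : Fin n → Fin m → ℝ, (∀ i g, 0 ≤ v i g) →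
        ∀ (i : Fin n) (v' : Fin m → ℝ), (∀ g, 0 ≤ v' g) →
        ∑ g, M (Function.update v i v') i g * v i g ≤ ∑ g, M v i g * v i g) := by
  have hne : (feas s B).Nonempty := ⟨0, by simp [feas, hB]⟩
  have hex : ∀ v : Fin n → Fin m → ℝ, ∃ x, x ∈ lexOpt (feas s B) (agentVal v) n := fun v =>
    (lexOpt_compact _ _ (feas_compact s B) hne (agentVal_continuous v) n).2
  choose M hM using hex
  refine ⟨M, fun v _ => ?_, fun v _ i v' _ => ?_⟩
  · have hF : M v ∈ feas s B := lexOpt_anti _ _ (Nat.zero_le n) (hM v)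
    refine ⟨hF.1, hF.2.1, hF.2.2, ?_⟩
    rintro ⟨y, hy1, hy2, hy3, hle, i, hlt⟩
    have h := (lexOpt_pareto _ _ n (M v) y (hM v) ⟨hy1, hy2, hy3⟩ (fun j hj => by
      have := hle ⟨j, hj⟩
      simpa [agentVal, hj] using this)).2 i i.2
    rw [agentVal_fin, agentVal_fin] at h
    linarith
  · have h1 : M v ∈ lexOpt (feas s B) (agentVal v) (i + 1) := lexOpt_anti _ _ i.2 (hM v)
    have h2 := lexOpt_anti _ _ i.2.le (hM (Function.update v i v'))
    rw [lexOpt_congr _ _ (agentVal v) i] at h2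
    · have h3 := h1.2 _ h2
      rwa [agentVal_fin, agentVal_fin] at h3
    · intro j hj
      funext x
      have hjn : j < n := hj.trans i.2
      have hne' : (⟨j, hjn⟩ : Fin n) ≠ i := fun h => by
        rw [← h] at hj
        exact lt_irrefl _ hj
      simp [agentVal, hjn, Function.update_of_ne hne']
end
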